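/- arXiv:2602.07927 — 5 statements merged into one kernel-verified Lean document; each statement's English description precedes it below -/
import Mathlib

section
/- Let G be a finite connected simple graph of order at least 2. Then ⌈(diam(G)+1)/3⌉ ≤ MP(G) ≤ γ_b(G), where diam(G) is the diameter of G, MP(G) the multipacking number, and γ_b(G) the broadcast domination number. -/
open SimpleGraph

variable {V : Type*}

/-- The diameter of a graph: the supremum of distances between pairs of vertices. -/
noncomputable def gDiam (G : SimpleGraph V) : ℕ :=
  sSup (Set.range fun p : V × V => G.dist p.1 p.2)

/-- A multipacking of a graph `G` is a set `M` of vertices such that for every vertex `v`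
and every integer `r ≥ 1`, the ball of radius `r` around `v` contains at most `r`
vertices of `M`. -/
def IsMultipacking (G : SimpleGraph V) (M : Set V) : Prop :=
  ∀ v : V, ∀ r : ℕ, 1 ≤ r → (M ∩ {u | G.dist u v ≤ r}).ncard ≤ r

/-- The multipacking number of `G`: the maximum size of a multipacking. -/
noncomputable def multipackingNumber (G : SimpleGraph V) : ℕ :=
  sSup {n | ∃ M : Set V, IsMultipacking G M ∧ M.ncard = n}

/-- A dominating broadcast: a function `f : V → ℕ` bounded above by the diameter,
such that every vertex `u` is within distance `f v` of some vertex `v` with `f v > 0`. -/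
def IsDominatingBroadcast (G : SimpleGraph V) (f : V → ℕ) : Prop :=
  (∀ v : V, f v ≤ gDiam G) ∧ ∀ u : V, ∃ v : V, 0 < f v ∧ G.dist u v ≤ f v

/-- The broadcast domination number of `G`: the minimum cost of a dominating broadcast. -/
noncomputable def broadcastDominationNumber (G : SimpleGraph V) : ℕ :=
  sInf {c | ∃ f : V → ℕ, IsDominatingBroadcast G f ∧ ∑ᶠ v : V, f v = c}

theorem bddAbove_range_dist [Finite V] (G : SimpleGraph V) :
    BddAbove (Set.range fun p : V × V => G.dist p.1 p.2) :=
  (Set.finite_range _).bddAbove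

theorem dist_le_gDiam [Finite V] (G : SimpleGraph V) (u v : V) : G.dist u v ≤ gDiam G :=
  le_csSup (bddAbove_range_dist G) ⟨(u, v), rfl⟩

theorem exists_dist_eq_gDiam [Finite V] [Nonempty V] (G : SimpleGraph V) :
    ∃ u v, G.dist u v = gDiam G := by
  obtain ⟨p, hp⟩ := Nat.sSup_mem (Set.range_nonempty _) (bddAbove_range_dist G)
  exact ⟨p.1, p.2, hp⟩

theorem SimpleGraph.Connected.exists_dist_eq {G : SimpleGraph V} (hconn : G.Connected)
    {u w : V} {k : ℕ} (hk : k ≤ G.dist u w) : ∃ x, G.dist u x = k := by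
  obtain ⟨p, hp⟩ := hconn.exists_walk_length_eq_dist u w
  refine ⟨p.getVert k, ?_⟩
  have h1 := dist_le (p.take k)
  have h2 := dist_le (p.drop k)
  have h3 := hconn.dist_triangle (u := u) (v := p.getVert k) (w := w)
  simp only [Walk.take_length, Walk.drop_length] at h1 h2
  omega

/-- Choosing one vertex in every third distance layer around `u` gives a multipacking. -/
theorem isMultipacking_image_of_dist_eq [Finite V] {G : SimpleGraph V} (hconn : G.Connected)
    {u : V} {n : ℕ} {x : ℕ → V} (hx : ∀ i < n, G.dist u (x i) = 3 * i) :
    IsMultipacking G (x '' Set.Iio n) := by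
  intro v r hr
  rcases Set.eq_empty_or_nonempty (x '' Set.Iio n ∩ {y | G.dist y v ≤ r}) with h | h
  · simp [h]
  obtain ⟨y, ⟨⟨i, hi, rfl⟩, hiv⟩, hmin⟩ := Set.exists_min_image _ (G.dist u) (Set.toFinite _) h
  have hsub : x '' Set.Iio n ∩ {y | G.dist y v ≤ r} ⊆
      x '' (Finset.Icc i (i + 2 * r / 3) : Finset ℕ) := by
    rintro _ ⟨⟨j, hj, rfl⟩, hjv⟩
    have hij := hmin (x j) ⟨⟨j, hj, rfl⟩, hjv⟩
    have h1 := hconn.dist_triangle (u := u) (v := x i) (w := x j)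
    have h2 := hconn.dist_triangle (u := x i) (v := v) (w := x j)
    rw [G.dist_comm (u := v)] at h2
    simp only [Set.mem_ofPred_eq] at hiv hjv
    rw [hx i hi, hx j hj] at hij h1
    refine ⟨j, ?_, rfl⟩
    simp only [Finset.coe_Icc, Set.mem_Icc]
    omega
  have h1 := Set.ncard_le_ncard hsub (Set.toFinite _)
  have h2 := Set.ncard_image_le (f := x) (Finset.finite_toSet (Finset.Icc i (i + 2 * r / 3)))
  rw [Set.ncard_coe_finset, Nat.card_Icc] at h2
  omega

theorem IsMultipacking.ncard_le_multipackingNumber [Finite V] {G : SimpleGraph V} {M : Set V}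
    (hM : IsMultipacking G M) : M.ncard ≤ multipackingNumber G := by
  refine le_csSup ⟨Nat.card V, ?_⟩ ⟨M, hM, rfl⟩
  rintro _ ⟨N, -, rfl⟩
  exact Set.ncard_le_card N

theorem gDiam_div_three_add_one_le_multipackingNumber [Finite V] {G : SimpleGraph V}
    (hconn : G.Connected) : gDiam G / 3 + 1 ≤ multipackingNumber G := by
  have := hconn.nonempty
  obtain ⟨u, w, huw⟩ := exists_dist_eq_gDiam G
  have hex : ∀ i, ∃ y, i < gDiam G / 3 + 1 → G.dist u y = 3 * i := by
    intro i
    by_cases hi : i < gDiam G / 3 + 1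
    · obtain ⟨y, hy⟩ := hconn.exists_dist_eq (u := u) (w := w) (k := 3 * i) (by omega)
      exact ⟨y, fun _ => hy⟩
    · exact ⟨u, fun h => absurd h hi⟩
  choose x hx using hex
  have hinj : Set.InjOn x (Set.Iio (gDiam G / 3 + 1)) := by
    intro i hi j hj hij
    have h1 := hx i hi
    have h2 := hx j hj
    rw [hij] at h1
    omega
  have hcard := (isMultipacking_image_of_dist_eq hconn hx).ncard_le_multipackingNumber
  rwa [hinj.ncard_image, ← Finset.coe_Iio, Set.ncard_coe_finset,
    Nat.card_Iio] at hcard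

theorem IsMultipacking.ncard_le_finsum [Finite V] {G : SimpleGraph V} {M : Set V} {f : V → ℕ}
    (hM : IsMultipacking G M) (hf : IsDominatingBroadcast G f) : M.ncard ≤ ∑ᶠ v, f v := by
  classical
  have := Fintype.ofFinite V
  rw [finsum_eq_sum_of_fintype]
  set B : V → Finset V := fun v => if 0 < f v then (M ∩ {u | G.dist u v ≤ f v}).toFinset else ∅
    with hB
  have hsub : M.toFinset ⊆ Finset.univ.biUnion B := by
    intro u hu
    obtain ⟨v, hv, huv⟩ := hf.2 u
    refine Finset.mem_biUnion.2 ⟨v, Finset.mem_univ v, ?_⟩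
    simpa [hB, hv, huv] using hu
  rw [Set.ncard_eq_toFinset_card']
  refine (Finset.card_le_card hsub).trans (Finset.card_biUnion_le.trans
    (Finset.sum_le_sum fun v _ => ?_))
  by_cases hv : 0 < f v
  · have h := hM v (f v) hv
    rw [Set.ncard_eq_toFinset_card'] at h
    simpa only [hB, if_pos hv] using h
  · simp [hB, hv]

theorem gDiam_pos [Finite V] [Nontrivial V] {G : SimpleGraph V} (hconn : G.Connected) :
    0 < gDiam G := by
  obtain ⟨a, b, hab⟩ := exists_pair_ne V
  exact (hconn.pos_dist_of_ne hab).trans_le (dist_le_gDiam G a b)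

theorem multipackingNumber_le_broadcastDominationNumber [Finite V] [Nontrivial V]
    {G : SimpleGraph V} (hconn : G.Connected) :
    multipackingNumber G ≤ broadcastDominationNumber G := by
  refine csSup_le ⟨0, ∅, fun v r _ => by simp, by simp⟩ ?_
  rintro _ ⟨M, hM, rfl⟩
  refine le_csInf ⟨_, fun _ => gDiam G, ⟨fun _ => le_rfl, fun u => ⟨u, gDiam_pos hconn, ?_⟩⟩,
    rfl⟩ ?_
  · simp
  · rintro _ ⟨f, hf, rfl⟩
    exact hM.ncard_le_finsum hf

/-- For a finite connected graph of order at least 2,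
⌈(diam(G)+1)/3⌉ ≤ MP(G) ≤ γ_b(G). -/
theorem stmt1 {V : Type*} [Fintype V] (G : SimpleGraph V) (hconn : G.Connected)
    (horder : 2 ≤ Fintype.card V) :
    ⌈((gDiam G : ℚ) + 1) / 3⌉₊ ≤ multipackingNumber G ∧
      multipackingNumber G ≤ broadcastDominationNumber G := by
  have : Nontrivial V := Fintype.one_lt_card_iff_nontrivial.1 horder
  refine ⟨(Nat.ceil_le.2 ?_).trans (gDiam_div_three_add_one_le_multipackingNumber hconn),
    multipackingNumber_le_broadcastDominationNumber hconn⟩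
  rw [div_le_iff₀ (by norm_num)]
  have h : gDiam G + 1 ≤ (gDiam G / 3 + 1) * 3 := by omega
  exact_mod_cast h
end

section
/- If G is a finite connected chordal graph, then γ_b(G) ≤ ⌈(3/2)·MP(G)⌉, where γ_b(G) is the broadcast domination number and MP(G) is the multipacking number of G. -/
open SimpleGraph

variable {V : Type*}

/-- A graph is chordal if it has no induced cycle of length at least 4
(equivalently, every cycle of length at least 4 has a chord). -/
def IsChordal (G : SimpleGraph V) : Prop :=
  ∀ n : ℕ, 4 ≤ n → ¬∃ f : Fin n ↪ V, ∀ a b : Fin n,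
    G.Adj (f a) (f b) ↔ (SimpleGraph.cycleGraph n).Adj a b

/-- A cyclic sequence of `m ≥ 4` distinct vertices whose only adjacencies are the consecutive ones
does not exist in a chordal graph. -/
theorem IsChordal.not_inducedCycle {G : SimpleGraph V} (hG : IsChordal G) {m : ℕ} (hm : 4 ≤ m)
    (g : ℕ → V) (hne : ∀ i j, i < j → j < m → g i ≠ g j)
    (hadj : ∀ i j, i < j → j < m → (G.Adj (g i) (g j) ↔ j = i + 1 ∨ (i = 0 ∧ j = m - 1))) :
    False := by
  have hcyc : ∀ a b : Fin m, a.val < b.val →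
      ((cycleGraph m).Adj a b ↔ b.val = a.val + 1 ∨ (a.val = 0 ∧ b.val = m - 1)) := by
    intro a b hab
    have ha := a.isLt
    have hb := b.isLt
    rw [cycleGraph_adj', Fin.coe_sub_iff_lt.2 hab, Fin.sub_val_of_le (Fin.le_of_lt hab)]
    omega
  refine hG m hm ⟨⟨fun i => g i, fun a b h => ?_⟩, fun a b => ?_⟩
  · rcases lt_trichotomy a.val b.val with hab | hab | hab
    · exact absurd h (hne _ _ hab b.isLt)
    · exact Fin.ext hab
    · exact absurd h.symm (hne _ _ hab a.isLt)
  · rcases lt_trichotomy a.val b.val with hab | hab | hab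
    · rw [hcyc a b hab]
      exact hadj _ _ hab b.isLt
    · obtain rfl := Fin.ext hab
      simp
    · rw [G.adj_comm, (cycleGraph m).adj_comm, hcyc b a hab]
      exact hadj _ _ hab a.isLt

/-- The `i`-th vertex of a geodesic is at distance `i` from its start. -/
theorem SimpleGraph.Walk.dist_getVert_of_length_eq_dist {G : SimpleGraph V} {u v : V}
    (w : G.Walk u v) (hw : w.length = G.dist u v) {i : ℕ} (hi : i ≤ w.length) :
    G.dist u (w.getVert i) = i := by
  have h1 := dist_le (w.take i)
  have h2 := dist_le (w.drop i)
  have h3 := (w.take i).reachable.dist_triangle_left v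
  rw [Walk.take_length] at h1
  rw [Walk.drop_length] at h2
  omega

/-- Distances from a fixed vertex increase by at most one along an edge. -/
theorem SimpleGraph.Adj.dist_le_succ {G : SimpleGraph V} {u v w : V} (h : G.Adj v w)
    (hr : G.Reachable u v) : G.dist u w ≤ G.dist u v + 1 := by
  have := hr.dist_triangle_left w
  rw [dist_eq_one_iff_adj.2 h] at this
  exact this

/-- In a chordal graph, if the outer neighbourhood of a connected set `C` is a clique, then some
vertex of `C` is adjacent to all of this neighbourhood. -/
theorem IsChordal.exists_adj_all_boundary [Finite V] {G : SimpleGraph V} (hG : IsChordal G)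
    {C : Set V} (hC : (G.induce C).Connected)
    (hclique : ∀ x y, x ∉ C → y ∉ C → x ≠ y → (∃ a ∈ C, G.Adj a x) → (∃ a ∈ C, G.Adj a y) →
      G.Adj x y) :
    ∃ c ∈ C, ∀ x, x ∉ C → (∃ a ∈ C, G.Adj a x) → G.Adj c x := by
  have := hC.nonempty
  obtain ⟨c, hc⟩ := Finite.exists_max fun c : C => {x | x ∉ C ∧ G.Adj c x}.ncard
  refine ⟨c, c.2, fun y hy hay => ?_⟩
  by_contra hcy
  have hex : ∃ n, ∃ q : C, G.Adj q y ∧ (G.induce C).dist c q = n := by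
    obtain ⟨a, ha, hay⟩ := hay
    exact ⟨_, ⟨a, ha⟩, hay, rfl⟩
  classical
  obtain ⟨q, hqy, hq⟩ := Nat.find_spec hex
  set n := Nat.find hex
  have hmin : ∀ q' : C, G.Adj q' y → n ≤ (G.induce C).dist c q' := fun q' h' =>
    Nat.find_min' hex ⟨q', h', rfl⟩
  obtain ⟨w, hw⟩ := hC.exists_walk_length_eq_dist c q
  have hwn : w.length = n := hw.trans hq
  have hd : ∀ i ≤ n, (G.induce C).dist c (w.getVert i) = i := fun i hi =>
    w.dist_getVert_of_length_eq_dist hw (hwn ▸ hi)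
  have hqn : w.getVert n = q := hwn ▸ w.getVert_length
  have hss : {x | x ∉ C ∧ G.Adj c x} ⊂ {x | x ∉ C ∧ G.Adj q x} := by
    refine ⟨fun x hx => ⟨hx.1, ?_⟩, fun h => hcy (h ⟨hy, hqy⟩).2⟩
    by_contra hqx
    have hxy : x ≠ y := fun h => hcy (h ▸ hx.2)
    have hadjxy : G.Adj x y := hclique x y hx.1 hy hxy ⟨c, c.2, hx.2⟩ ⟨q, q.2, hqy⟩
    obtain ⟨a, ⟨han, hax⟩, hamax⟩ : ∃ a, (a ≤ n ∧ G.Adj (w.getVert a) x) ∧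
        ∀ b, a < b → b ≤ n → ¬ G.Adj (w.getVert b) x := by
      let P := fun a => G.Adj (w.getVert a) x
      have h0 : P 0 := by simpa [P] using hx.2
      exact ⟨Nat.findGreatest P n, ⟨Nat.findGreatest_le n,
        Nat.findGreatest_spec (P := P) (Nat.zero_le n) h0⟩,
        fun b hab hbn => Nat.findGreatest_is_greatest hab hbn⟩
    have han' : a < n := lt_of_le_of_ne han fun h => hqx (by rwa [h, hqn] at hax)
    have hgeo : ∀ i j, i < j → j ≤ n →
        (G.Adj (w.getVert i) (w.getVert j) ↔ j = i + 1) := by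
      intro i j hij hj
      constructor
      · intro h
        have := SimpleGraph.Adj.dist_le_succ (G := G.induce C) (u := c) h (hC c _)
        rw [hd i (by omega), hd j hj] at this
        omega
      · rintro rfl
        exact w.adj_getVert_succ (by omega)
    have hgne : ∀ i j, i < j → j ≤ n → (w.getVert i : V) ≠ w.getVert j := by
      intro i j hij hj h
      have h1 := hd i (by omega)
      rw [Subtype.ext h, hd j hj] at h1
      omega
    have hgy : ∀ i ≤ n, (G.Adj (w.getVert i) y ↔ i = n) := by
      intro i hi
      constructor
      · intro h
        have := hmin _ h
        rw [hd i hi] at this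
        omega
      · rintro rfl
        rwa [hqn]
    have hgx : ∀ i, a ≤ i → i ≤ n → (G.Adj (w.getVert i) x ↔ i = a) := by
      intro i hai hi
      constructor
      · intro h
        by_contra hne
        exact hamax i (by omega) hi h
      · rintro rfl
        exact hax
    have hny : ∀ i, (w.getVert i : V) ≠ y := fun i h => hy (h ▸ (w.getVert i).2)
    have hnx : ∀ i, (w.getVert i : V) ≠ x := fun i h => hx.1 (h ▸ (w.getVert i).2)
    refine hG.not_inducedCycle (m := n - a + 3) (by omega)
      (fun j => if j ≤ n - a then (w.getVert (a + j) : V) else if j = n - a + 1 then y else x)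
      (fun i j hij hj => ?_) (fun i j hij hj => ?_)
    · split_ifs
      · exact hgne _ _ (by omega) (by omega)
      · exact hny _
      · exact hnx _
      all_goals first | omega | exact hxy.symm
    · split_ifs
      · rw [hgeo _ _ (by omega) (by omega)]
        omega
      · rw [hgy _ (by omega)]
        omega
      · rw [hgx _ (by omega) (by omega)]
        omega
      all_goals first
        | omega
        | exact iff_of_true hadjxy.symm (by omega)
  exact absurd (hc q) (not_le.2 (Set.ncard_lt_ncard hss (Set.toFinite _)))

/-- A property that propagates along the edges inside a ball holds at all vertices of the ball as
soon as it holds at one. -/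
theorem SimpleGraph.Connected.ball_propagate {G : SimpleGraph V} (hconn : G.Connected) {u : V}
    {k : ℕ} {P : V → Prop}
    (hP : ∀ x y, G.Adj x y → G.dist u x ≤ k → G.dist u y ≤ k → P x → P y)
    {v : V} (hvk : G.dist u v ≤ k) (hv : P v) {w : V} (hwk : G.dist u w ≤ k) : P w := by
  have key : ∀ n, ∀ w, G.dist u w = n → n ≤ k → (P u ↔ P w) := by
    intro n
    induction n with
    | zero =>
      intro w hw _
      rw [hconn.dist_eq_zero_iff.1 hw]
    | succ n ih =>
      intro w hw hn
      obtain ⟨p, hp⟩ := hconn.exists_walk_length_eq_dist u w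
      have hd := p.dist_getVert_of_length_eq_dist hp (i := n) (by omega)
      have hadj : G.Adj (p.getVert n) w := by
        have := p.adj_getVert_succ (i := n) (by omega)
        rwa [show n + 1 = p.length by omega, p.getVert_length] at this
      rw [ih _ hd (by omega)]
      exact ⟨hP _ _ hadj (by omega) (by omega), hP _ _ hadj.symm (by omega) (by omega)⟩
  exact (key _ w rfl hwk).1 ((key _ v rfl hvk).2 hv)

/-- If all distances in a connected chordal graph are at most `2 * k + 1`, then some vertex has
eccentricity at most `k + 1`. -/
theorem IsChordal.exists_dist_le [Finite V] {G : SimpleGraph V} (hG : IsChordal G)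
    (hconn : G.Connected) {k : ℕ} (hk : ∀ u v, G.dist u v ≤ 2 * k + 1) :
    ∃ c, ∀ u, G.dist u c ≤ k + 1 := by
  by_contra! hcon
  let 𝒮 : Set (Set V) := {C | (∀ x y, x ∉ C → y ∉ C → x ≠ y →
    (∃ a ∈ C, G.Adj a x) → (∃ a ∈ C, G.Adj a y) → G.Adj x y) ∧
    ∃ u, ∀ w, G.dist u w ≤ k → w ∈ C}
  have hne : 𝒮.Nonempty :=
    ⟨Set.univ, fun x _ hx => absurd (Set.mem_univ x) hx, hconn.nonempty.some, fun _ _ => trivial⟩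
  obtain ⟨C, ⟨hclique, u, hu⟩, hmin⟩ := (wellFounded_lt (α := Set V)).has_min 𝒮 hne
  have huC : u ∈ C := hu u (by simp)
  let R : Set V := {w | ∃ h : w ∈ C, (G.induce C).Reachable ⟨u, huC⟩ ⟨w, h⟩}
  have hRC : R ⊆ C := fun w hw => hw.1
  have hRclosed : ∀ x y, x ∈ R → G.Adj x y → y ∈ C → y ∈ R := by
    rintro x y ⟨hx, hr⟩ hxy hy
    have : (G.induce C).Adj ⟨x, hx⟩ ⟨y, hy⟩ := hxy
    exact ⟨hy, hr.trans this.reachable⟩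
  have hR : R ∈ 𝒮 := by
    have hout : ∀ x, x ∉ R → (∃ a ∈ R, G.Adj a x) → x ∉ C := by
      rintro x hx ⟨a, ha, hax⟩ hxC
      exact hx (hRclosed a x ha hax hxC)
    refine ⟨fun x y hx hy hxy hax hay => ?_, u, fun w hw => ?_⟩
    · refine hclique x y (hout x hx hax) (hout y hy hay) hxy ?_ ?_
      · exact hax.imp fun a h => ⟨hRC h.1, h.2⟩
      · exact hay.imp fun a h => ⟨hRC h.1, h.2⟩
    · exact hconn.ball_propagate (P := (· ∈ R))
        (fun x y hxy _ hy hx => hRclosed x y hx hxy (hu y hy)) (v := u) (by simp)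
        ⟨huC, Reachable.refl _⟩ hw
  have hRC' : C ⊆ R := by
    by_contra h
    exact hmin R hR ⟨hRC, h⟩
  have hCconn : (G.induce C).Connected := by
    rw [connected_iff_exists_forall_reachable]
    exact ⟨⟨u, huC⟩, fun w => (hRC' w.2).2⟩
  obtain ⟨c, hcC, hc⟩ := hG.exists_adj_all_boundary hCconn hclique
  refine hmin (C \ {c}) ⟨?_, ?_⟩ ⟨Set.sdiff_subset, fun h => (h hcC).2 rfl⟩
  · have hside : ∀ x, x ∉ C \ {c} → (∃ a ∈ C \ {c}, G.Adj a x) →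
        x = c ∨ (x ∉ C ∧ ∃ a ∈ C, G.Adj a x) := by
      rintro x hx ⟨a, ha, hax⟩
      by_cases hxc : x = c
      · exact Or.inl hxc
      · exact Or.inr ⟨fun h => hx ⟨h, hxc⟩, a, ha.1, hax⟩
    intro x y hx hy hxy hax hay
    rcases hside x hx hax with rfl | ⟨hx', hax'⟩ <;> rcases hside y hy hay with rfl | ⟨hy', hay'⟩
    · exact absurd rfl hxy
    · exact hc y hy' hay'
    · exact (hc x hx' hax').symm
    · exact hclique x y hx' hy' hxy hax' hay'
  · obtain ⟨u', hu'⟩ := hcon c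
    have hstep : ∀ x y, x ∈ C → G.Adj x y → G.dist u' y ≤ k → y ∈ C := by
      intro x y hx hxy hy
      by_contra hyC
      have := (hc y hyC ⟨x, hx, hxy⟩).symm.dist_le_succ (hconn u' y)
      omega
    obtain ⟨b, hbk, hbC⟩ : ∃ b, G.dist u' b ≤ k ∧ b ∈ C := by
      obtain ⟨p, hp⟩ := hconn.exists_walk_length_eq_dist u u'
      have hl : p.length ≤ 2 * k + 1 := hp ▸ hk u u'
      by_cases hlk : p.length ≤ k
      · exact ⟨u', by simp, hu u' (hp ▸ hlk)⟩
      · have hdk := p.dist_getVert_of_length_eq_dist hp (i := k) (by omega)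
        have hd := dist_le (p.drop (k + 1))
        rw [Walk.drop_length, dist_comm] at hd
        have hbk : G.dist u' (p.getVert (k + 1)) ≤ k := by omega
        exact ⟨_, hbk, hstep _ _ (hu _ hdk.le) (p.adj_getVert_succ (by omega)) hbk⟩
    refine ⟨u', fun w hw => ⟨?_, ?_⟩⟩
    · exact hconn.ball_propagate (P := (· ∈ C)) (fun x y hxy _ hy hx => hstep x y hx hxy hy)
        hbk hbC hw
    · rintro rfl
      omega

/-- Every third vertex of a geodesic, starting from its first vertex, yields a multipacking. -/
theorem SimpleGraph.Connected.div_three_lt_multipackingNumber [Finite V] {G : SimpleGraph V}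
    (hconn : G.Connected) (u v : V) : G.dist u v / 3 < multipackingNumber G := by
  obtain ⟨p, hp⟩ := hconn.exists_walk_length_eq_dist u v
  have hd : ∀ i ≤ G.dist u v, G.dist u (p.getVert i) = i := fun i hi =>
    p.dist_getVert_of_length_eq_dist hp (hp ▸ hi)
  let g : ℕ → V := fun i => p.getVert (3 * i)
  have hg : ∀ i < G.dist u v / 3 + 1, G.dist u (g i) = 3 * i := fun i hi => hd _ (by omega)
  have hinj : Set.InjOn g (Finset.range (G.dist u v / 3 + 1)) := by
    intro i hi j hj hij
    have h1 := hg i (by simpa using hi)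
    rw [hij, hg j (by simpa using hj)] at h1
    omega
  refine Nat.lt_of_succ_le (le_csSup ⟨Nat.card V, ?_⟩
    ⟨g '' (Finset.range (G.dist u v / 3 + 1)), fun x r hr => ?_, ?_⟩)
  · rintro _ ⟨M, -, rfl⟩
    exact Set.ncard_le_card M
  · set I := {i | i < G.dist u v / 3 + 1 ∧ G.dist (g i) x ≤ r} with hI
    have hsub : g '' (Finset.range (G.dist u v / 3 + 1)) ∩ {u | G.dist u x ≤ r} ⊆ g '' I := by
      rintro _ ⟨⟨i, hi, rfl⟩, hx⟩
      exact ⟨i, ⟨by simpa using hi, hx⟩, rfl⟩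
    have hfin : I.Finite := (Set.finite_lt_nat (G.dist u v / 3 + 1)).subset fun i hi => hi.1
    refine (Set.ncard_le_ncard hsub (hfin.image g)).trans ((Set.ncard_image_le hfin).trans ?_)
    rcases I.eq_empty_or_nonempty with h | h
    · simp [h]
    have h0 := Nat.sInf_mem h
    set a := sInf I
    have hIcc : I ⊆ Finset.Ico a (a + r) := by
      intro i hi
      have hai : a ≤ i := Nat.sInf_le hi
      have h1 := hconn.dist_triangle (u := u) (v := g a) (w := g i)
      have h2 := hconn.dist_triangle (u := g a) (v := x) (w := g i)
      rw [hg _ h0.1, hg _ hi.1] at h1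
      rw [dist_comm (u := x)] at h2
      have h3 := h0.2
      have h4 := hi.2
      simp only [Finset.coe_Ico, Set.mem_Ico]
      omega
    have := Set.ncard_le_ncard hIcc (Finset.finite_toSet _)
    rw [Set.ncard_coe_finset, Nat.card_Ico] at this
    omega
  · rw [hinj.ncard_image, Set.ncard_coe_finset, Finset.card_range]

/-- The broadcast domination number of a connected chordal graph of diameter `d` is at most
`d / 2 + 1`. The hypothesis excludes the one-vertex graph, which has no dominating broadcast. -/
theorem IsChordal.broadcastDominationNumber_le [Finite V] {G : SimpleGraph V} (hG : IsChordal G)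
    (hconn : G.Connected) (hd : gDiam G ≠ 0) :
    broadcastDominationNumber G ≤ gDiam G / 2 + 1 := by
  obtain ⟨c, hc⟩ := hG.exists_dist_le hconn (k := gDiam G / 2) fun u v => by
    have := dist_le_gDiam G u v
    omega
  classical
  refine Nat.sInf_le ⟨Pi.single c (gDiam G / 2 + 1), ⟨fun v => ?_, fun u => ⟨c, ?_, ?_⟩⟩, ?_⟩
  · rw [Pi.single_apply]
    split_ifs <;> omega
  · simp
  · simpa using hc u
  · rw [finsum_eq_single _ c fun v hv => Pi.single_eq_of_ne hv _, Pi.single_eq_same]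

theorem broadcastDominationNumber_eq_zero [Nonempty V] {G : SimpleGraph V} (hd : gDiam G = 0) :
    broadcastDominationNumber G = 0 := by
  refine Nat.sInf_eq_zero.2 (Or.inr (Set.eq_empty_of_forall_notMem ?_))
  rintro _ ⟨f, ⟨hf, hdom⟩, -⟩
  obtain ⟨v, hv, -⟩ := hdom (Classical.arbitrary V)
  have := hf v
  omega

/-- For a finite connected chordal graph, γ_b(G) ≤ ⌈(3/2)·MP(G)⌉. -/
theorem stmt2 {V : Type*} [Fintype V] (G : SimpleGraph V) (hconn : G.Connected)
    (hchordal : IsChordal G) :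
    broadcastDominationNumber G ≤ ⌈(3 / 2 : ℚ) * multipackingNumber G⌉₊ := by
  have := hconn.nonempty
  by_cases hd : gDiam G = 0
  · simp [broadcastDominationNumber_eq_zero hd]
  refine (hchordal.broadcastDominationNumber_le hconn hd).trans ?_
  obtain ⟨u, v, huv⟩ := exists_dist_eq_gDiam G
  have hmp := hconn.div_three_lt_multipackingNumber u v
  rw [huv] at hmp
  have hceil := Nat.le_ceil ((3 / 2 : ℚ) * multipackingNumber G)
  have h : 3 * multipackingNumber G ≤ 2 * ⌈(3 / 2 : ℚ) * multipackingNumber G⌉₊ := by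
    have : (3 * multipackingNumber G : ℚ) ≤ 2 * ⌈(3 / 2 : ℚ) * multipackingNumber G⌉₊ := by
      linarith
    exact_mod_cast this
  omega
end

section
/- For every positive integer k, there exists a finite connected chordal graph H_k such that MP(H_k) = 9k and γ_b(H_k) = 10k. -/
open SimpleGraph

variable {V : Type*}

/-! ### General facts -/

/-- A graph with a perfect elimination ordering is chordal: here `R` orients the edges
along a rank function, and the out-neighbours of every vertex form a clique. -/
theorem isChordal_fromRel {R : V → V → Prop} (rank : V → ℕ)
    (hrank : ∀ u v, R u v → rank u < rank v)
    (hclique : ∀ v w w', R v w → R v w' → w ≠ w' → R w w' ∨ R w' w) :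
    IsChordal (SimpleGraph.fromRel R) := by
  rintro n hn ⟨f, hf⟩
  obtain ⟨m, rfl⟩ : ∃ m, n = m + 4 := ⟨n - 4, by omega⟩
  obtain ⟨i, hi⟩ := Finite.exists_min fun i => rank (f i)
  have key : ∀ j, (SimpleGraph.cycleGraph (m + 4)).Adj i j → R (f i) (f j) := by
    intro j hj
    rcases ((SimpleGraph.fromRel_adj _ _ _).1 ((hf i j).2 hj)).2 with h | h
    · exact h
    · exact absurd (hrank _ _ h) (not_lt.2 (hi j))
  have h1 := key (i + 1) (by rw [SimpleGraph.cycleGraph_adj]; right; abel)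
  have h2 := key (i - 1) (by rw [SimpleGraph.cycleGraph_adj]; left; abel)
  have e : (i + 1) - (i - 1) = 2 := by
    have : (i + 1) - (i - 1) = 1 + 1 := by abel
    rw [this]; rfl
  have e' : (i - 1) - (i + 1) = -2 := by rw [← e]; abel
  have hval : ((2 : Fin (m + 4)) : ℕ) = 2 := Nat.mod_eq_of_lt (by omega : 2 < m + 4)
  have t1 : (2 : Fin (m + 4)) ≠ 0 := by
    rw [Ne, Fin.ext_iff, hval]; simp
  have t2 : (2 : Fin (m + 4)) ≠ 1 := by
    rw [Ne, Fin.ext_iff, hval]; simp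
  have t3 : (-2 : Fin (m + 4)) ≠ 1 := by
    intro h
    have h3 : (2 : Fin (m + 4)) + 1 = 0 := by rw [← h]; abel
    rw [Fin.ext_iff, Fin.val_add, hval, Fin.val_one', Nat.mod_eq_of_lt (by omega : 1 < m + 4),
      Nat.mod_eq_of_lt (by omega : 2 + 1 < m + 4)] at h3
    simp at h3
  have hne : i + 1 ≠ i - 1 := fun h => t1 (by rw [← e, h, sub_self])
  have hadj : (SimpleGraph.fromRel R).Adj (f (i + 1)) (f (i - 1)) :=
    (SimpleGraph.fromRel_adj _ _ _).2
      ⟨fun h => hne (f.injective h), hclique _ _ _ h1 h2 fun h => hne (f.injective h)⟩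
  rw [hf, SimpleGraph.cycleGraph_adj, e, e'] at hadj
  exact hadj.elim t2 t3

/-- A function changing by at most one along edges is `1`-Lipschitz for the graph distance. -/
theorem le_add_dist {G : SimpleGraph V} (hG : G.Connected) {g : V → ℕ}
    (hg : ∀ u w, G.Adj u w → g u ≤ g w + 1) (u v : V) : g u ≤ g v + G.dist u v := by
  obtain ⟨p, hp⟩ := hG.exists_walk_length_eq_dist u v
  rw [← hp]
  clear hp
  induction p with
  | nil => simp
  | cons h p ih =>
    have := hg _ _ h
    simp only [SimpleGraph.Walk.length_cons]
    omega

/-- If a `1`-Lipschitz function is at most one on the closed neighbourhood of `v`, then it is at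
most `r` on the ball of radius `r ≥ 1` around `v`. -/
theorem le_of_dist_le {G : SimpleGraph V} (hG : G.Connected) {g : V → ℕ}
    (hg : ∀ u w, G.Adj u w → g u ≤ g w + 1) {v : V} (hv : g v ≤ 1)
    (hN : ∀ w, G.Adj v w → g w ≤ 1) {r : ℕ} (hr : 1 ≤ r) {u : V} (hu : G.dist u v ≤ r) :
    g u ≤ r := by
  obtain ⟨p, hp⟩ := hG.exists_walk_length_eq_dist v u
  rw [SimpleGraph.dist_comm, ← hp] at hu
  cases p with
  | nil => omega
  | @cons _ w _ h p =>
    have h1 := le_add_dist hG hg u w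
    have h2 := hN w h
    have h3 := SimpleGraph.dist_le p
    rw [SimpleGraph.dist_comm] at h3
    simp only [SimpleGraph.Walk.length_cons] at hu
    omega

/-- A set of naturals without consecutive elements, each of whose elements lies in `T` together
with its predecessor, has at most `T.card / 2` elements. -/
theorem ncard_le_of_pairs {S : Set ℕ} {T : Finset ℕ} {r : ℕ} (hT : T.card ≤ 2 * r)
    (hS : ∀ q ∈ S, 1 ≤ q ∧ q ∈ T ∧ q - 1 ∈ T ∧ q - 1 ∉ S) : S.ncard ≤ r := by
  classical
  have hfin : S.Finite := T.finite_toSet.subset fun q hq => (hS q hq).2.1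
  obtain ⟨S, rfl⟩ := hfin.exists_finset_coe
  rw [Set.ncard_coe_finset]
  simp only [Finset.mem_coe] at hS
  have hinj : Set.InjOn (fun q => q - 1) (S : Set ℕ) := by
    intro a ha b hb hab
    have := (hS a ha).1
    have := (hS b hb).1
    simp only at hab
    omega
  have hdisj : Disjoint S (S.image fun q => q - 1) := by
    rw [Finset.disjoint_left]
    intro a ha hb
    obtain ⟨b, hb', rfl⟩ := Finset.mem_image.1 hb
    exact (hS b hb').2.2.2 ha
  have hsub : S ∪ (S.image fun q => q - 1) ⊆ T := by
    intro a ha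
    rcases Finset.mem_union.1 ha with ha | ha
    · exact (hS a ha).2.1
    · obtain ⟨b, hb, rfl⟩ := Finset.mem_image.1 ha
      exact (hS b hb).2.2.1
  have := Finset.card_le_card hsub
  rw [Finset.card_union_of_disjoint hdisj, Finset.card_image_of_injOn hinj] at this
  omega

/-- Weak duality between broadcasts and (half-integral) multipackings: if `t` lists `2 * n` vertices
so that every ball of radius `r` receives at most `2 * r` of them, then every dominating broadcast
costs at least `n`. -/
theorem le_cost_of_half_packing [Fintype V] {G : SimpleGraph V} {n : ℕ} (t : Fin (2 * n) → V)
    (ht : ∀ v r, 1 ≤ r → {s | G.dist (t s) v ≤ r}.ncard ≤ 2 * r)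
    {f : V → ℕ} (hf : IsDominatingBroadcast G f) : n ≤ ∑ v, f v := by
  classical
  have hcover : (Finset.univ : Finset (Fin (2 * n))) ⊆
      (Finset.univ.filter fun v => 0 < f v).biUnion
        fun v => Finset.univ.filter fun s => G.dist (t s) v ≤ f v := by
    intro s _
    obtain ⟨v, hv, hd⟩ := hf.2 (t s)
    simp only [Finset.mem_biUnion, Finset.mem_filter, Finset.mem_univ, true_and]
    exact ⟨v, hv, hd⟩
  have h1 := (Finset.card_le_card hcover).trans Finset.card_biUnion_le
  have h2 : ∑ v ∈ Finset.univ.filter (fun v => 0 < f v),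
      (Finset.univ.filter fun s => G.dist (t s) v ≤ f v).card ≤
      ∑ v ∈ Finset.univ.filter (fun v => 0 < f v), 2 * f v := by
    refine Finset.sum_le_sum fun v hv => ?_
    have := ht v (f v) (Finset.mem_filter.1 hv).2
    rwa [Set.ncard_eq_toFinset_card', Set.toFinset_ofPred] at this
  have h3 : ∑ v ∈ Finset.univ.filter (fun v => 0 < f v), 2 * f v ≤ ∑ v, 2 * f v :=
    Finset.sum_le_sum_of_subset (Finset.filter_subset _ _)
  rw [← Finset.mul_sum Finset.univ] at h3
  simp only [Finset.card_univ, Fintype.card_fin] at h1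
  omega

namespace SunComb

/-! ### The graph

A path on `20 * k` vertices, with pendant leaves at the positions satisfying `HasLeaf`. At the
consecutive positions `a`, `a + 1` with `IsSun a` there are two more vertices, `tip a` and `hub a`,
adjacent to both path vertices; `hub a` is also adjacent to both leaves, so these six vertices
induce a 3-sun. -/

def IsSun (p : ℕ) : Prop := p % 20 = 3 ∨ p % 20 = 18

def HasLeaf (p : ℕ) : Prop :=
  p % 20 = 1 ∨ p % 20 = 3 ∨ p % 20 = 4 ∨ (6 ≤ p % 20 ∧ p % 2 = 0) ∨ p % 20 = 19

inductive Vert (k : ℕ) : Type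
  | path (p : ℕ) (h : p < 20 * k) : Vert k
  | leaf (p : ℕ) (h : p < 20 * k) (hp : HasLeaf p) : Vert k
  | tip (a : ℕ) (h : a < 20 * k) (ha : IsSun a) : Vert k
  | hub (a : ℕ) (h : a < 20 * k) (ha : IsSun a) : Vert k

open Vert

variable {k : ℕ}

def pos : Vert k → ℕ
  | path p _ => p
  | leaf p _ _ => p
  | tip a _ _ => a
  | hub a _ _ => a

/-- The edges, oriented along a perfect elimination ordering. -/
def Arc : Vert k → Vert k → Prop
  | path p _, path q _ => p + 1 = q
  | leaf p _ _, path q _ => p = q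
  | leaf p _ _, hub a _ _ => p = a ∨ p = a + 1
  | tip a _ _, path q _ => q = a ∨ q = a + 1
  | hub a _ _, path q _ => q = a ∨ q = a + 1
  | _, _ => False

def rank : Vert k → ℕ
  | path p _ => p + 2
  | leaf _ _ _ => 0
  | tip _ _ _ => 0
  | hub _ _ _ => 1

def graph (k : ℕ) : SimpleGraph (Vert k) := SimpleGraph.fromRel Arc

/-- The distance from a vertex to the path vertex at position `p`. -/
def pathDist (p : ℕ) : Vert k → ℕ
  | path q _ => Nat.dist p q
  | leaf q _ _ => Nat.dist p q + 1
  | tip a _ _ => min (Nat.dist p a) (Nat.dist p (a + 1)) + 1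
  | hub a _ _ => min (Nat.dist p a) (Nat.dist p (a + 1)) + 1

theorem arc_rank (u v : Vert k) (h : Arc u v) : rank u < rank v := by
  cases u <;> cases v <;> simp only [Arc, rank] at h ⊢ <;> omega

theorem adj_of_arc {u v : Vert k} (h : Arc u v) : (graph k).Adj u v :=
  (SimpleGraph.fromRel_adj _ _ _).2
    ⟨fun e => lt_irrefl _ (e ▸ arc_rank u v h), Or.inl h⟩

theorem arc_or_arc {u v : Vert k} (h : (graph k).Adj u v) : Arc u v ∨ Arc v u :=
  ((SimpleGraph.fromRel_adj _ _ _).1 h).2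

instance : Finite (Vert k) := by
  refine Finite.of_injective
    (β := Fin (20 * k) ⊕ Fin (20 * k) ⊕ Fin (20 * k) ⊕ Fin (20 * k))
    (fun v => match v with
      | path p h => Sum.inl ⟨p, h⟩
      | leaf p h _ => Sum.inr (Sum.inl ⟨p, h⟩)
      | tip p h _ => Sum.inr (Sum.inr (Sum.inl ⟨p, h⟩))
      | hub p h _ => Sum.inr (Sum.inr (Sum.inr ⟨p, h⟩))) ?_
  intro u v h
  cases u <;> cases v <;> simp_all

theorem isChordal_graph : IsChordal (graph k) := by
  refine isChordal_fromRel rank arc_rank ?_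
  intro v w w' h h' hne
  cases v <;> cases w <;> cases w' <;>
    simp only [Arc, ne_eq, path.injEq, hub.injEq] at h h' hne ⊢ <;>
    (try simp only [IsSun] at *) <;> omega

/-! ### Distances -/

theorem reachable_path {p q : ℕ} (hp : p < 20 * k) (hq : q < 20 * k) :
    (graph k).Reachable (path p hp) (path q hq) := by
  have key : ∀ n (hn : n < 20 * k),
      (graph k).Reachable (path 0 (by omega)) (path n hn) := by
    intro n
    induction n with
    | zero => intro _; rfl
    | succ n ih =>
      intro hn
      exact (ih (by omega)).trans (adj_of_arc (by simp [Arc])).reachable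
  exact (key p hp).symm.trans (key q hq)

theorem exists_path_reachable (u : Vert k) :
    ∃ p, ∃ hp : p < 20 * k, (graph k).Reachable u (path p hp) := by
  cases u with
  | path p h => exact ⟨p, h, .rfl⟩
  | leaf p h hp => exact ⟨p, h, (adj_of_arc (by simp [Arc])).reachable⟩
  | tip p h hp => exact ⟨p, h, (adj_of_arc (by simp [Arc])).reachable⟩
  | hub p h hp => exact ⟨p, h, (adj_of_arc (by simp [Arc])).reachable⟩

theorem connected_graph (hk : 0 < k) : (graph k).Connected := by
  refine (SimpleGraph.connected_iff _).2 ⟨fun u v => ?_, ⟨path 0 (by omega)⟩⟩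
  obtain ⟨p, hp, h⟩ := exists_path_reachable u
  obtain ⟨q, hq, h'⟩ := exists_path_reachable v
  exact (h.trans (reachable_path hp hq)).trans h'.symm

theorem pathDist_lipschitz (p : ℕ) (u v : Vert k) (h : (graph k).Adj u v) :
    pathDist p u ≤ pathDist p v + 1 := by
  rcases arc_or_arc h with h | h <;> cases u <;> cases v <;>
    simp only [Arc, pathDist, Nat.dist] at h ⊢ <;> omega

theorem dist_path_path_le (hk : 0 < k) {p : ℕ} (hp : p < 20 * k) (n : ℕ) (hn : p + n < 20 * k) :
    (graph k).dist (path p hp) (path (p + n) hn) ≤ n := by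
  induction n with
  | zero => simp
  | succ n ih =>
    have h1 := ih (by omega)
    have h2 : (graph k).Adj (path (p + n) (by omega)) (path (p + (n + 1)) hn) :=
      adj_of_arc (by simp [Arc, add_assoc])
    have h3 := (connected_graph hk).dist_triangle (u := path p hp)
      (v := path (p + n) (by omega)) (w := path (p + (n + 1)) hn)
    rw [SimpleGraph.dist_eq_one_iff_adj.2 h2] at h3
    omega

theorem dist_path_path_le_dist (hk : 0 < k) {p q : ℕ} (hp : p < 20 * k) (hq : q < 20 * k) :
    (graph k).dist (path q hq) (path p hp) ≤ Nat.dist p q := by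
  rcases le_total p q with h | h
  · obtain ⟨n, rfl⟩ := Nat.exists_eq_add_of_le h
    rw [SimpleGraph.dist_comm]
    exact (dist_path_path_le hk hp n hq).trans (by simp only [Nat.dist]; omega)
  · obtain ⟨n, rfl⟩ := Nat.exists_eq_add_of_le h
    exact (dist_path_path_le hk hq n hp).trans (by simp only [Nat.dist]; omega)

theorem dist_path_le (hk : 0 < k) {p : ℕ} (hp : p < 20 * k) (u : Vert k) :
    (graph k).dist u (path p hp) ≤ pathDist p u := by
  have step : ∀ q (hq : q < 20 * k), Arc u (path q hq) →
      (graph k).dist u (path p hp) ≤ Nat.dist p q + 1 := by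
    intro q hq h
    have h1 := (connected_graph hk).dist_triangle (u := u) (v := path q hq) (w := path p hp)
    rw [SimpleGraph.dist_eq_one_iff_adj.2 (adj_of_arc h)] at h1
    have h2 := dist_path_path_le_dist hk hp hq
    omega
  cases u with
  | path q hq => exact dist_path_path_le_dist hk hp hq
  | leaf q hq _ => exact step q hq rfl
  | tip a h ha =>
    have h1 := step a h (Or.inl rfl)
    have h2 := step (a + 1) (by unfold IsSun at ha; omega) (Or.inr rfl)
    simp only [pathDist]
    omega
  | hub a h ha =>
    have h1 := step a h (Or.inl rfl)
    have h2 := step (a + 1) (by unfold IsSun at ha; omega) (Or.inr rfl)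
    simp only [pathDist]
    omega

/-- A modification of `pathDist (a + 1)` that is adapted to balls centred at `hub a`. -/
def hubDist (a : ℕ) : Vert k → ℕ
  | path q _ => if q = a + 1 then 1 else Nat.dist (a + 1) q
  | leaf q _ _ => if q = a then 1 else Nat.dist (a + 1) q + 1
  | tip b _ _ => if b = a then 2 else min (Nat.dist (a + 1) b) (Nat.dist (a + 1) (b + 1)) + 1
  | hub b _ _ => min (Nat.dist (a + 1) b) (Nat.dist (a + 1) (b + 1)) + 1

theorem hubDist_lipschitz (a : ℕ) (u v : Vert k) (h : (graph k).Adj u v) :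
    hubDist a u ≤ hubDist a v + 1 := by
  rcases arc_or_arc h with h | h <;> cases u <;> cases v <;>
    simp only [Arc, hubDist, Nat.dist] at h ⊢ <;> (try split_ifs) <;> omega

/-- Balls of radius `r ≥ 1` are controlled by `pathDist` or, when centred at a hub, by `hubDist`. -/
theorem ball_control (hk : 0 < k) (v : Vert k) {r : ℕ} (hr : 1 ≤ r) :
    (∃ p, ∀ u, (graph k).dist u v ≤ r → pathDist p u ≤ r) ∨
      ∃ a, IsSun a ∧ ∀ u, (graph k).dist u v ≤ r → hubDist a u ≤ r := by
  have hG := connected_graph hk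
  cases v with
  | hub a h ha =>
    refine Or.inr ⟨a, ha, fun u hu => le_of_dist_le hG (hubDist_lipschitz a) ?_ ?_ hr hu⟩
    · simp [hubDist, Nat.dist]
    · intro w hw
      rcases arc_or_arc hw with h | h <;> cases w <;>
        simp only [Arc, hubDist, Nat.dist] at h ⊢ <;> (try split_ifs) <;> omega
  | path p h =>
    refine Or.inl ⟨p, fun u hu => ?_⟩
    have := le_add_dist hG (pathDist_lipschitz p) u (path p h)
    rw [show pathDist p (path p h) = 0 from Nat.dist_self p, zero_add] at this
    exact this.trans hu
  | leaf p h hp =>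
    refine Or.inl ⟨p, fun u hu => le_of_dist_le hG (pathDist_lipschitz p) ?_ ?_ hr hu⟩
    · simp [pathDist]
    · intro w hw
      rcases arc_or_arc hw with h | h <;> cases w <;>
        simp only [Arc, pathDist, Nat.dist] at h ⊢ <;> omega
  | tip p h hp =>
    refine Or.inl ⟨p, fun u hu => le_of_dist_le hG (pathDist_lipschitz p) ?_ ?_ hr hu⟩
    · simp [pathDist]
    · intro w hw
      rcases arc_or_arc hw with h | h <;> cases w <;>
        simp only [Arc, pathDist, Nat.dist] at h ⊢ <;> omega

/-! ### Broadcast domination number -/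

open Classical in
/-- A half-integral multipacking of total weight `10 * k`. -/
noncomputable def token (s : Fin (2 * (10 * k))) : Vert k :=
  if h : IsSun s then tip s (by omega) h
  else if h' : HasLeaf s then leaf s (by omega) h'
  else leaf (s + 1) (by unfold IsSun HasLeaf at *; omega) (by unfold IsSun HasLeaf at *; omega)

theorem mem_of_pathDist_token_le {p r : ℕ} {s : Fin (2 * (10 * k))}
    (h : pathDist p (token s) ≤ r) : (s : ℕ) ∈ Finset.Ico (p - r) (p + r) := by
  unfold token at h
  rw [Finset.mem_Ico]
  split_ifs at h <;> simp only [pathDist, Nat.dist] at h <;> omega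

theorem mem_of_hubDist_token_le {a r : ℕ} (hr : 1 ≤ r) (ha : IsSun a) {s : Fin (2 * (10 * k))}
    (h : hubDist a (token s) ≤ r) :
    (s : ℕ) ∈ if r = 1 then {a - 1, a + 1} else Finset.Ico (a + 1 - r) (a + 1 + r) := by
  unfold token at h
  unfold IsSun at ha
  split_ifs at h ⊢ <;> simp only [hubDist, Nat.dist, IsSun] at * <;>
    simp only [Finset.mem_Ico, Finset.mem_insert, Finset.mem_singleton] <;>
    split_ifs at h <;> omega

theorem ncard_token_le (hk : 0 < k) (v : Vert k) (r : ℕ) (hr : 1 ≤ r) :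
    {s : Fin (2 * (10 * k)) | (graph k).dist (token s) v ≤ r}.ncard ≤ 2 * r := by
  have key : ∀ T : Finset ℕ, T.card ≤ 2 * r →
      (∀ s : Fin (2 * (10 * k)), (graph k).dist (token s) v ≤ r → (s : ℕ) ∈ T) →
      {s : Fin (2 * (10 * k)) | (graph k).dist (token s) v ≤ r}.ncard ≤ 2 * r := by
    intro T hT h
    rw [← Set.ncard_image_of_injective _ Fin.val_injective]
    refine le_trans ?_ hT
    rw [← Set.ncard_coe_finset]
    refine Set.ncard_le_ncard ?_ T.finite_toSet
    rintro _ ⟨s, hs, rfl⟩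
    exact h s hs
  rcases ball_control hk v hr with ⟨p, h⟩ | ⟨a, ha, h⟩
  · exact key _ (by rw [Nat.card_Ico]; omega) fun s hs => mem_of_pathDist_token_le (h _ hs)
  · refine key _ ?_ fun s hs => mem_of_hubDist_token_le hr ha (h _ hs)
    split_ifs with h1
    · exact Finset.card_le_two.trans (by omega)
    · rw [Nat.card_Ico]; omega

theorem pathDist_center_le (u : Vert k) : pathDist (10 * k) u ≤ 10 * k := by
  cases u <;> simp only [pathDist, Nat.dist] <;> (try simp only [HasLeaf, IsSun] at *) <;> omega

theorem exists_broadcast (hk : 0 < k) :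
    ∃ f : Vert k → ℕ, IsDominatingBroadcast (graph k) f ∧ ∑ᶠ v, f v = 10 * k := by
  classical
  let c : Vert k := path (10 * k) (by omega)
  refine ⟨Pi.single c (10 * k), ⟨fun v => ?_, fun u => ⟨c, ?_, ?_⟩⟩, ?_⟩
  · have h1 := dist_le_gDiam (graph k) (path (20 * k - 1) (by omega)) (path 0 (by omega))
    have h2 := le_add_dist (connected_graph hk) (pathDist_lipschitz 0)
      (path (20 * k - 1) (by omega)) (path 0 (by omega))
    simp only [pathDist, Nat.dist] at h2
    by_cases hv : v = c
    · subst hv; simp only [Pi.single_eq_same]; omega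
    · simp [Pi.single_eq_of_ne hv]
  · simp [hk]
  · simpa using (dist_path_le hk (by omega) u).trans (pathDist_center_le u)
  · rw [finsum_eq_single _ c fun v hv => Pi.single_eq_of_ne hv _, Pi.single_eq_same]

theorem broadcastDominationNumber_graph (hk : 0 < k) :
    broadcastDominationNumber (graph k) = 10 * k := by
  have := Fintype.ofFinite (Vert k)
  refine le_antisymm (Nat.sInf_le (exists_broadcast hk)) ?_
  refine le_csInf ⟨_, exists_broadcast hk⟩ ?_
  rintro c ⟨f, hf, rfl⟩
  rw [finsum_eq_sum_of_fintype]
  exact le_cost_of_half_packing token (ncard_token_le hk) hf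

/-! ### Multipacking number -/

/-- The leaves at all positions that are not the second position of a sun. -/
def packing (k : ℕ) : Set (Vert k) := {v | ∃ p h hp, v = leaf p h hp ∧ p % 20 ≠ 4 ∧ p % 20 ≠ 19}

theorem injOn_pos_packing : Set.InjOn pos (packing k) := by
  rintro _ ⟨p, h, hp, rfl, -⟩ _ ⟨q, h', hq, rfl, -⟩ e
  simp only [pos] at e
  subst e
  rfl

theorem isMultipacking_packing (hk : 0 < k) : IsMultipacking (graph k) (packing k) := by
  intro v r hr
  rw [← (injOn_pos_packing.mono Set.inter_subset_left).ncard_image]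
  have key : ∀ T : Finset ℕ, T.card ≤ 2 * r →
      (∀ p h hp, p % 20 ≠ 4 → p % 20 ≠ 19 → (graph k).dist (leaf p h hp) v ≤ r →
        p ∈ T ∧ p - 1 ∈ T) →
      (Set.image pos (packing k ∩ {u | (graph k).dist u v ≤ r})).ncard ≤ r := by
    intro T hT h
    refine ncard_le_of_pairs hT ?_
    rintro _ ⟨_, ⟨⟨p, hp, hp', rfl, h4, h19⟩, hd⟩, rfl⟩
    obtain ⟨h1, h2⟩ := h p hp hp' h4 h19 hd
    refine ⟨?_, h1, h2, ?_⟩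
    · simp only [pos]; unfold HasLeaf at hp'; omega
    · rintro ⟨_, ⟨⟨q, hq, hq', rfl, g4, g19⟩, -⟩, e⟩
      simp only [pos] at e
      unfold HasLeaf at hp' hq'
      omega
  rcases ball_control hk v hr with ⟨p, h⟩ | ⟨a, ha, h⟩
  · refine key (Finset.Ico (p - r) (p + r)) (by rw [Nat.card_Ico]; omega) ?_
    intro q hq hq' _ _ hd
    have := h _ hd
    simp only [pathDist, Nat.dist] at this
    simp only [Finset.mem_Ico]
    omega
  · refine key (if r = 1 then {a - 1, a} else Finset.Ico (a + 1 - r) (a + 1 + r)) ?_ ?_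
    · split_ifs with h1
      · exact Finset.card_le_two.trans (by omega)
      · rw [Nat.card_Ico]; omega
    intro q hq hq' h4 h19 hd
    have := h _ hd
    unfold IsSun at ha
    simp only [hubDist, Nat.dist] at this
    split_ifs at this ⊢ <;>
      simp only [Finset.mem_Ico, Finset.mem_insert, Finset.mem_singleton] <;> omega

theorem le_ncard_packing : 9 * k ≤ (packing k).ncard := by
  have hdef : ∀ i : Fin k × Fin 9,
      20 * (i.1 : ℕ) + (if (i.2 : ℕ) < 2 then 2 * (i.2 : ℕ) + 1 else 2 * (i.2 : ℕ) + 2) < 20 * k ∧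
      HasLeaf (20 * (i.1 : ℕ) + (if (i.2 : ℕ) < 2 then 2 * (i.2 : ℕ) + 1 else 2 * (i.2 : ℕ) + 2)) := by
    rintro ⟨⟨i, hi⟩, ⟨j, hj⟩⟩
    unfold HasLeaf
    dsimp only
    split_ifs <;> omega
  have hinj : Function.Injective fun i : Fin k × Fin 9 => leaf _ (hdef i).1 (hdef i).2 := by
    rintro ⟨⟨i, hi⟩, ⟨j, hj⟩⟩ ⟨⟨i', hi'⟩, ⟨j', hj'⟩⟩ e
    simp only [leaf.injEq] at e
    simp only [Prod.mk.injEq, Fin.mk.injEq]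
    split_ifs at e <;> omega
  have h1 := Set.ncard_range_of_injective hinj
  rw [Nat.card_prod, Nat.card_fin, Nat.card_fin] at h1
  have h2 : (Set.range fun i : Fin k × Fin 9 => leaf _ (hdef i).1 (hdef i).2) ⊆ packing k := by
    rintro _ ⟨⟨⟨i, hi⟩, ⟨j, hj⟩⟩, rfl⟩
    refine ⟨_, _, _, rfl, ?_⟩
    dsimp only
    split_ifs <;> omega
  have h3 := Set.ncard_le_ncard h2 (Set.toFinite _)
  omega

theorem exists_common_neighbor (hk : 0 < k) {a : ℕ} (h : a < 20 * k) (ha : IsSun a) {u v : Vert k}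
    (hu : pos u = a ∨ pos u = a + 1) (hv : pos v = a ∨ pos v = a + 1) :
    ∃ w, (graph k).dist u w ≤ 1 ∧ (graph k).dist v w ≤ 1 := by
  have h' : a + 1 < 20 * k := by unfold IsSun at ha; omega
  have cases_of : ∀ u : Vert k, pos u = a ∨ pos u = a + 1 →
      (pathDist a u ≤ 1 ∧ pathDist (a + 1) u ≤ 1) ∨
      (pathDist a u ≤ 1 ∧ (graph k).dist u (hub a h ha) ≤ 1) ∨
      (pathDist (a + 1) u ≤ 1 ∧ (graph k).dist u (hub a h ha) ≤ 1) := by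
    intro u hu
    unfold IsSun at ha
    cases u with
    | leaf p hp hl =>
      have : (graph k).dist (leaf p hp hl) (hub a h ha) ≤ 1 :=
        (SimpleGraph.dist_eq_one_iff_adj.2 (adj_of_arc (u := leaf p hp hl) (v := hub a h ha) hu)).le
      simp only [pos, pathDist, Nat.dist, this, and_true] at *
      omega
    | path p hp => left; simp only [pos, pathDist, Nat.dist] at *; omega
    | tip p hp hs => 
      left; simp only [pos, pathDist, Nat.dist] at hu ⊢; unfold IsSun at hs; omega
    | hub p hp hs => 
      left; simp only [pos, pathDist, Nat.dist] at hu ⊢; unfold IsSun at hs; omega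
  have ba : ∀ u, pathDist a u ≤ 1 → _ := fun u hu => (dist_path_le hk h u).trans hu
  have bb : ∀ u, pathDist (a + 1) u ≤ 1 → _ := fun u hu => (dist_path_le hk h' u).trans hu
  rcases cases_of u hu with ⟨h1, h2⟩ | ⟨h1, h2⟩ | ⟨h1, h2⟩ <;>
  rcases cases_of v hv with ⟨h3, h4⟩ | ⟨h3, h4⟩ | ⟨h3, h4⟩ <;>
  first
    | exact ⟨_, ba u h1, ba v h3⟩
    | exact ⟨_, bb u h1, bb v h3⟩
    | exact ⟨_, bb u h2, bb v h3⟩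
    | exact ⟨_, bb u h1, bb v h4⟩
    | exact ⟨_, h2, h4⟩

theorem card_filter_le_of_pathDist_le (hk : 0 < k) {M : Finset (Vert k)}
    (hM : IsMultipacking (graph k) M) {P : Vert k → Prop} [DecidablePred P] {p r : ℕ}
    (hp : p < 20 * k) (hr : 1 ≤ r) (hP : ∀ u, P u → pathDist p u ≤ r) :
    (M.filter P).card ≤ r := by
  refine le_trans ?_ (hM (path p hp) r hr)
  rw [← Set.ncard_coe_finset]
  refine Set.ncard_le_ncard ?_ (Set.toFinite _)
  intro u hu
  have hu := Finset.mem_filter.1 (Finset.mem_coe.1 hu)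
  exact ⟨hu.1, (dist_path_le hk hp u).trans (hP u hu.2)⟩

theorem card_filter_sun_le (hk : 0 < k) {M : Finset (Vert k)}
    (hM : IsMultipacking (graph k) M) {P : Vert k → Prop} [DecidablePred P] {a : ℕ}
    (h : a < 20 * k) (ha : IsSun a) (hP : ∀ u, P u → pos u = a ∨ pos u = a + 1) :
    (M.filter P).card ≤ 1 := by
  refine Finset.card_le_one.2 fun u hu v hv => ?_
  rw [Finset.mem_filter] at hu hv
  obtain ⟨w, h1, h2⟩ := exists_common_neighbor hk h ha (hP u hu.2) (hP v hv.2)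
  exact (Set.ncard_le_one (Set.toFinite _)).1 (hM w 1 le_rfl) u ⟨hu.1, h1⟩ v ⟨hv.1, h2⟩

theorem card_period_le (hk : 0 < k) {M : Finset (Vert k)} (hM : IsMultipacking (graph k) M)
    {i : ℕ} (hi : i < k) : (M.filter fun u => pos u / 20 = i).card ≤ 9 := by
  classical
  have h1 : (M.filter fun u => 20 * i ≤ pos u ∧ pos u ≤ 20 * i + 2).card ≤ 1 := by
    refine card_filter_le_of_pathDist_le hk hM (p := 20 * i + 1) (by omega) le_rfl ?_
    intro u hu
    cases u <;> simp only [pos, pathDist, Nat.dist] at hu ⊢ <;>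
      (try simp only [HasLeaf, IsSun] at *) <;> omega
  have h2 : (M.filter fun u => pos u = 20 * i + 3 ∨ pos u = 20 * i + 3 + 1).card ≤ 1 :=
    card_filter_sun_le hk hM (by omega) (by unfold IsSun; omega) fun u hu => hu
  have h3 : (M.filter fun u => 20 * i + 5 ≤ pos u ∧ pos u ≤ 20 * i + 17).card ≤ 6 := by
    refine card_filter_le_of_pathDist_le hk hM (p := 20 * i + 11) (by omega) (by omega) ?_
    intro u hu
    cases u <;> simp only [pos, pathDist, Nat.dist] at hu ⊢ <;>
      (try simp only [HasLeaf, IsSun] at *) <;> omega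
  have h4 : (M.filter fun u => pos u = 20 * i + 18 ∨ pos u = 20 * i + 18 + 1).card ≤ 1 :=
    card_filter_sun_le hk hM (by omega) (by unfold IsSun; omega) fun u hu => hu
  have hsub : (M.filter fun u => pos u / 20 = i) ⊆
      ((M.filter fun u => 20 * i ≤ pos u ∧ pos u ≤ 20 * i + 2) ∪
        (M.filter fun u => pos u = 20 * i + 3 ∨ pos u = 20 * i + 3 + 1)) ∪
      ((M.filter fun u => 20 * i + 5 ≤ pos u ∧ pos u ≤ 20 * i + 17) ∪
        (M.filter fun u => pos u = 20 * i + 18 ∨ pos u = 20 * i + 18 + 1)) := by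
    intro u hu
    simp only [Finset.mem_union, Finset.mem_filter] at hu ⊢
    obtain ⟨hM, hu⟩ := hu
    simp only [hM, true_and]
    omega
  have h5 := Finset.card_le_card hsub
  have h6 := Finset.card_union_le
    ((M.filter fun u => 20 * i ≤ pos u ∧ pos u ≤ 20 * i + 2) ∪
        (M.filter fun u => pos u = 20 * i + 3 ∨ pos u = 20 * i + 3 + 1))
    ((M.filter fun u => 20 * i + 5 ≤ pos u ∧ pos u ≤ 20 * i + 17) ∪
        (M.filter fun u => pos u = 20 * i + 18 ∨ pos u = 20 * i + 18 + 1))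
  have h7 := Finset.card_union_le (M.filter fun u => 20 * i ≤ pos u ∧ pos u ≤ 20 * i + 2)
    (M.filter fun u => pos u = 20 * i + 3 ∨ pos u = 20 * i + 3 + 1)
  have h8 := Finset.card_union_le (M.filter fun u => 20 * i + 5 ≤ pos u ∧ pos u ≤ 20 * i + 17)
    (M.filter fun u => pos u = 20 * i + 18 ∨ pos u = 20 * i + 18 + 1)
  omega

theorem ncard_le_of_isMultipacking (hk : 0 < k) {M : Set (Vert k)}
    (hM : IsMultipacking (graph k) M) : M.ncard ≤ 9 * k := by
  obtain ⟨M, rfl⟩ := M.toFinite.exists_finset_coe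
  rw [Set.ncard_coe_finset]
  have := Finset.card_le_mul_card_image_of_maps_to (s := M) (f := fun u => pos u / 20)
    (t := Finset.range k) ?_ 9 ?_
  · simpa using this
  · intro u _
    simp only [Finset.mem_range]
    cases u <;> simp only [pos] <;> omega
  · exact fun i hi => card_period_le hk hM (Finset.mem_range.1 hi)

theorem multipackingNumber_graph (hk : 0 < k) : multipackingNumber (graph k) = 9 * k := by
  have hub : ∀ n ∈ {n | ∃ M : Set (Vert k), IsMultipacking (graph k) M ∧ M.ncard = n},
      n ≤ 9 * k := by
    rintro _ ⟨M, hM, rfl⟩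
    exact ncard_le_of_isMultipacking hk hM
  have hmem := isMultipacking_packing hk
  refine le_antisymm (csSup_le ⟨_, _, hmem, rfl⟩ hub) ?_
  exact le_ncard_packing.trans (le_csSup ⟨_, hub⟩ ⟨_, hmem, rfl⟩)

end SunComb

/-- For every positive integer k, there is a finite connected chordal
graph H_k with MP(H_k) = 9k and γ_b(H_k) = 10k. -/
theorem stmt3 (k : ℕ) (hk : 0 < k) :
    ∃ (V : Type) (G : SimpleGraph V), Finite V ∧ G.Connected ∧ IsChordal G ∧
      multipackingNumber G = 9 * k ∧ broadcastDominationNumber G = 10 * k :=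
  ⟨SunComb.Vert k, SunComb.graph k, inferInstance, SunComb.connected_graph hk,
    SunComb.isChordal_graph, SunComb.multipackingNumber_graph hk,
    SunComb.broadcastDominationNumber_graph hk⟩
end

section
/- For every natural number N, there exists a finite connected chordal graph G such that γ_b(G) − MP(G) ≥ N; that is, the difference between the broadcast domination number and the multipacking number can be arbitrarily large for connected chordal graphs. -/
open SimpleGraph

variable {V : Type*}

/-! ### General facts on distances, perfect elimination orderings, packings and broadcasts -/

section General

variable {W : Type*} {G : SimpleGraph W}

lemma sub_le_dist_of_lipschitz (hG : G.Connected) (φ : W → ℤ)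
    (hφ : ∀ u v, G.Adj u v → φ u - φ v ≤ 1) (u v : W) : φ u - φ v ≤ G.dist u v := by
  obtain ⟨p, hp⟩ := hG.exists_walk_length_eq_dist u v
  rw [← hp]
  clear hp
  induction p with
  | nil => simp
  | cons h p ih =>
    have := hφ _ _ h
    push_cast [SimpleGraph.Walk.length_cons]
    linarith

lemma abs_sub_le_dist_of_lipschitz (hG : G.Connected) (φ : W → ℤ)
    (hφ : ∀ u v, G.Adj u v → φ u - φ v ≤ 1) (u v : W) : |φ u - φ v| ≤ G.dist u v := by
  have h₁ := sub_le_dist_of_lipschitz hG φ hφ u v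
  have h₂ := sub_le_dist_of_lipschitz hG φ hφ v u
  rw [SimpleGraph.dist_comm] at h₂
  exact abs_le.2 ⟨by linarith, h₁⟩

lemma eq_or_adj_of_dist_le_one (hG : G.Connected) {u v : W} (h : G.dist u v ≤ 1) :
    u = v ∨ G.Adj u v := by
  rcases Nat.le_one_iff_eq_zero_or_eq_one.1 h with h | h
  · exact Or.inl (hG.dist_eq_zero_iff.1 h)
  · exact Or.inr (SimpleGraph.dist_eq_one_iff_adj.1 h)

/-- A graph with a perfect elimination ordering is chordal. -/
lemma isChordal_of_elimination (idx : W → ℕ) (hidx : Function.Injective idx)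
    (h : ∀ u v w, G.Adj u v → G.Adj u w → idx u < idx v → idx u < idx w → v ≠ w →
      G.Adj v w) : IsChordal G := by
  rintro n hn ⟨f, hf⟩
  obtain ⟨m, rfl⟩ : ∃ m, n = m + 4 := ⟨n - 4, by omega⟩
  obtain ⟨a, -, ha⟩ := Finset.exists_min_image Finset.univ (fun a => idx (f a))
    Finset.univ_nonempty
  have hlt : ∀ b, G.Adj (f a) (f b) → idx (f a) < idx (f b) := fun b hb =>
    lt_of_le_of_ne (ha b (Finset.mem_univ b)) fun e => hb.ne (hidx e)
  have two : (1 + 1 : Fin (m + 4)) ≠ 0 := by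
    simp [Fin.ext_iff, Fin.val_add, Nat.mod_eq_of_lt]
  have one : (1 : Fin (m + 4)) ≠ 0 := by simp
  have three : (1 + 1 + 1 : Fin (m + 4)) ≠ 0 := by
    simp [Fin.ext_iff, Fin.val_add, Nat.mod_eq_of_lt]
  have h₁ : G.Adj (f a) (f (a + 1)) := by
    rw [hf, cycleGraph_adj]; right; abel
  have h₂ : G.Adj (f a) (f (a - 1)) := by
    rw [hf, cycleGraph_adj]; left; abel
  have hne : f (a + 1) ≠ f (a - 1) := fun e => two <| by
    have e' : (a + 1) - (a - 1) = 0 := sub_eq_zero.2 (f.injective e)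
    rw [← e']; abel
  have h₃ := h _ _ _ h₁ h₂ (hlt _ h₁) (hlt _ h₂) hne
  rw [hf, cycleGraph_adj] at h₃
  rcases h₃ with h₃ | h₃
  · refine one ?_
    have e : ((a + 1) - (a - 1)) - 1 = (0 : Fin (m + 4)) := sub_eq_zero.2 h₃
    rw [← e]; abel
  · refine three ?_
    have e : 1 - ((a - 1) - (a + 1)) = (0 : Fin (m + 4)) := sub_eq_zero.2 h₃.symm
    rw [← e]; abel

lemma multipackingNumber_le {c : ℕ} (h : ∀ M : Set W, IsMultipacking G M → M.ncard ≤ c) :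
    multipackingNumber G ≤ c := by
  refine csSup_le ⟨0, ∅, fun v r _ => by simp, by simp⟩ ?_
  rintro _ ⟨M, hM, rfl⟩
  exact h M hM

lemma exists_isDominatingBroadcast [Finite W] [Nontrivial W] (hG : G.Connected) :
    ∃ f, IsDominatingBroadcast G f := by
  obtain ⟨a, b, hab⟩ := exists_pair_ne W
  have hpos : 0 < gDiam G := (hG.pos_dist_of_ne hab).trans_le <|
    le_csSup (Set.finite_range _).bddAbove ⟨(a, b), rfl⟩
  exact ⟨fun _ => gDiam G, fun _ => le_rfl, fun u => ⟨u, hpos, by simp⟩⟩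

/-- If every ball of radius `r` contains at most `2 * r` elements of `T` then every dominating
broadcast has cost at least half the size of `T`. -/
lemma card_le_two_mul_broadcastDominationNumber [Fintype W] [Nontrivial W] (hG : G.Connected)
    (T : Finset W)
    (hT : ∀ v r, 1 ≤ r → (T.filter fun u => G.dist u v ≤ r).card ≤ 2 * r) :
    T.card ≤ 2 * broadcastDominationNumber G := by
  classical
  obtain ⟨f₀, hf₀⟩ := exists_isDominatingBroadcast hG
  have hmem : broadcastDominationNumber G ∈
      {c | ∃ f : W → ℕ, IsDominatingBroadcast G f ∧ ∑ᶠ v : W, f v = c} :=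
    Nat.sInf_mem ⟨_, f₀, hf₀, rfl⟩
  obtain ⟨f, hf, hc⟩ := hmem
  rw [← hc, finsum_eq_sum_of_fintype, Finset.mul_sum]
  have hsub : T ⊆ Finset.univ.biUnion fun v =>
      T.filter fun u => 0 < f v ∧ G.dist u v ≤ f v := by
    intro u hu
    obtain ⟨v, hv⟩ := hf.2 u
    simp only [Finset.mem_biUnion, Finset.mem_filter, Finset.mem_univ, true_and]
    exact ⟨v, hu, hv⟩
  refine (Finset.card_le_card hsub).trans (Finset.card_biUnion_le.trans ?_)
  refine Finset.sum_le_sum fun v _ => ?_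
  rcases Nat.eq_zero_or_pos (f v) with h | h
  · simp [h]
  · simpa [h] using hT v (f v) h

end General

/-! ### The block: three suns joined by two link vertices

The sun with index `s` has vertices `7 * s + j` for `j < 6`: its tips are `j = 0, 1, 5` and its
central triangle is `j = 2, 3, 4`. The vertices `6` and `13` link consecutive suns. -/

/-- The edges of the block, from the smaller to the larger endpoint. -/
def blockEdge (k l : Fin 20) : Bool :=
  (k.val / 7 == l.val / 7 && [(0, 2), (0, 4), (1, 2), (1, 3), (2, 3), (2, 4), (3, 4), (3, 5),
    (4, 5), (5, 6)].contains (k.val % 7, l.val % 7)) ||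
  (k.val % 7 == 6 && l.val == k.val + 1)

/-- Adjacency in the block. -/
def blockAdj (k l : Fin 20) : Bool := blockEdge k l || blockEdge l k

/-- The column of a vertex of the block: its distance to the vertex `0`, except for the vertices
`1` and `3` of each sun, which are in the column of the central triangle. -/
def blockCol (k : Fin 20) : ℤ :=
  4 * (k.val / 7 : ℕ) + [0, 1, 1, 1, 1, 2, 3].getD (k.val % 7) 0

/-- The column function with the vertices `1` and `3` of each sun moved to the right. -/
def blockColRight (k : Fin 20) : ℤ :=
  4 * (k.val / 7 : ℕ) + [0, 2, 1, 2, 1, 2, 3].getD (k.val % 7) 0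

/-- The column function with the vertices `1` and `2` of each sun moved to the left. -/
def blockColLeft (k : Fin 20) : ℤ :=
  4 * (k.val / 7 : ℕ) + [0, 0, 0, 1, 1, 2, 3].getD (k.val % 7) 0

/-- The tips of the three suns of the block. -/
def blockTip (k : Fin 20) : Bool := [0, 1, 5].contains (k.val % 7)

/-- A column offset of absolute value at most one which is attained by no tip of the closed
neighbourhood. -/
def blockGap (k : Fin 20) : ℤ :=
  if k = 0 then 1 else [-1, -1, 1, -1, 0, if k = 19 then -1 else 1, 0].getD (k.val % 7) 0

/-- The chain of `m + 1` blocks, in which the last vertex of each block is joined to the first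
vertex of the next one. -/
def sunChain (m : ℕ) : SimpleGraph (Fin (m + 1) × Fin 20) where
  Adj u v := (u.1 = v.1 ∧ blockAdj u.2 v.2 = true) ∨
    (u.1.val + 1 = v.1.val ∧ u.2 = 19 ∧ v.2 = 0) ∨ (v.1.val + 1 = u.1.val ∧ v.2 = 19 ∧ u.2 = 0)
  symm := by
    constructor
    rintro u v (⟨h, h'⟩ | h | h)
    · refine Or.inl ⟨h.symm, ?_⟩
      rwa [blockAdj, Bool.or_comm]
    · exact Or.inr (Or.inr h)
    · exact Or.inr (Or.inl h)
  loopless := by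
    constructor
    rintro u (⟨-, h⟩ | h | h)
    · revert h
      generalize u.2 = k
      revert k
      decide
    · omega
    · omega

section Block

lemma blockCol_lipschitz : ∀ k l, blockAdj k l = true → blockCol k - blockCol l ≤ 1 := by
  decide

lemma blockColLeft_lipschitz :
    ∀ k l, blockAdj k l = true → blockColLeft k - blockColLeft l ≤ 1 := by
  decide

lemma blockColRight_lipschitz :
    ∀ k l, blockAdj k l = true → blockColRight k - blockColRight l ≤ 1 := by
  decide

lemma blockCol_bounds : ∀ k, 0 ≤ blockCol k ∧ blockCol k ≤ 10 := by
  decide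

lemma blockCol_injOn_tips :
    ∀ k l, blockTip k = true → blockTip l = true → blockCol k = blockCol l → k = l := by
  decide

lemma blockCol_tip_ne : ∀ k, blockTip k = true → blockCol k ≠ 3 ∧ blockCol k ≠ 7 := by
  decide

lemma abs_blockGap_le : ∀ k, |blockGap k| ≤ 1 := by
  decide

lemma blockGap_ne_zero_of_tip : ∀ k, blockTip k = true → blockGap k ≠ 0 := by
  decide

lemma blockCol_ne_add_blockGap :
    ∀ k l, blockTip k = true → blockAdj k l = true → blockCol k ≠ blockCol l + blockGap l := by
  decide

lemma exists_offset_le_two : ∀ k, k ≠ 0 → k ≠ 19 →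
    |3 - blockCol k| ≤ 2 ∨ |7 - blockCol k| ≤ 2 := by
  decide

lemma exists_offset_le_three : ∀ k,
    |3 - blockCol k| ≤ 3 ∨ |7 - blockCol k| ≤ 3 := by
  decide

lemma blockColLeft_eq_of_tip : ∀ k, blockTip k = true → blockCol k = 9 → blockColLeft k = 8 := by
  decide

lemma blockColRight_eq_of_tip :
    ∀ k, blockTip k = true → blockCol k = 1 → blockColRight k = 2 := by
  decide

lemma blockAdj_clique : ∀ k l, blockAdj k l = true → k < l →
    ∀ l', blockAdj k l' = true → k < l' → l ≠ l' → blockAdj l l' = true := by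
  decide

lemma exists_blockAdj_gt : ∀ k, k ≠ 19 → ∃ l, blockAdj k l = true ∧ k < l := by
  decide

lemma exists_common_blockAdj_of_lt : ∀ k l : Fin 20, (k.val < 6 ∧ l.val < 6) ∨
    (14 ≤ k.val ∧ 14 ≤ l.val) → ∃ c, (k = c ∨ blockAdj k c = true) ∧
      (l = c ∨ blockAdj l c = true) := by
  decide

lemma exists_blockAdj_eleven : ∀ k : Fin 20, 6 ≤ k.val → k.val < 14 →
    ∃ c, (k = c ∨ blockAdj k c = true) ∧ (c = 11 ∨ blockAdj c 11 = true) := by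
  decide

end Block

section Chain

variable {m : ℕ}

lemma sunChain_adj {u v : Fin (m + 1) × Fin 20} : (sunChain m).Adj u v ↔
    (u.1 = v.1 ∧ blockAdj u.2 v.2 = true) ∨ (u.1.val + 1 = v.1.val ∧ u.2 = 19 ∧ v.2 = 0) ∨
      (v.1.val + 1 = u.1.val ∧ v.2 = 19 ∧ u.2 = 0) :=
  Iff.rfl

/-- The position of a vertex in an elimination ordering of the chain. -/
def chainIdx (u : Fin (m + 1) × Fin 20) : ℕ := 20 * u.1.val + u.2.val

lemma chainIdx_injective : Function.Injective (chainIdx (m := m)) := by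
  rintro ⟨i, k⟩ ⟨j, l⟩ h
  simp only [chainIdx] at h
  ext <;> simp only <;> omega

lemma sunChain_isChordal : IsChordal (sunChain m) := by
  refine isChordal_of_elimination chainIdx chainIdx_injective ?_
  rintro ⟨i, k⟩ ⟨j, l⟩ ⟨j', l'⟩ h h' hlt hlt' hne
  simp only [sunChain_adj, chainIdx, ne_eq, Prod.mk.injEq, Fin.ext_iff] at *
  rcases h with ⟨h, ha⟩ | ⟨h, hk, hl⟩ | ⟨h, hk, hl⟩
  · rcases h' with ⟨h', ha'⟩ | ⟨h', hk', hl'⟩ | ⟨h', hk', hl'⟩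
    · left
      refine ⟨by omega, blockAdj_clique k l ha (by omega) l' ha' (by omega) (by omega)⟩
    · have : (19 : Fin 20).val = 19 := rfl
      omega
    · omega
  · rcases h' with ⟨h', ha'⟩ | ⟨h', hk', hl'⟩ | ⟨h', hk', hl'⟩
    · have : (19 : Fin 20).val = 19 := rfl
      omega
    · omega
    · omega
  · omega

lemma sunChain_connected : (sunChain m).Connected := by
  have key : ∀ d : ℕ, ∀ u : Fin (m + 1) × Fin 20, 20 * m + 19 - chainIdx u ≤ d →
      (sunChain m).Reachable u (Fin.last m, 19) := by
    intro d
    induction d with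
    | zero =>
      rintro ⟨i, k⟩ h
      have : (i, k) = (Fin.last m, (19 : Fin 20)) := by
        simp only [chainIdx] at h
        ext
        · simp only [Fin.val_last]; omega
        · change k.val = 19; omega
      rw [this]
    | succ d ih =>
      rintro ⟨i, k⟩ h
      simp only [chainIdx] at h
      by_cases hk : k = 19
      · by_cases hi : i = Fin.last m
        · rw [hk, hi]
        · have hi' : i.val < m := by
            have : i.val ≠ m := fun e => hi (Fin.ext e)
            omega
          have ha : (sunChain m).Adj (i, k) (⟨i.val + 1, by omega⟩, 0) :=
            Or.inr (Or.inl ⟨rfl, hk, rfl⟩)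
          refine ha.reachable.trans (ih _ ?_)
          have : k.val = 19 := by rw [hk]; rfl
          simp only [chainIdx, Fin.val_zero]
          omega
      · obtain ⟨l, hl, hlt⟩ := exists_blockAdj_gt k hk
        have ha : (sunChain m).Adj (i, k) (i, l) := Or.inl ⟨rfl, hl⟩
        refine ha.reachable.trans (ih _ ?_)
        simp only [chainIdx]
        omega
  have : Nonempty (Fin (m + 1) × Fin 20) := ⟨(0, 0)⟩
  exact ⟨fun u v => (key _ u le_rfl).trans (key _ v le_rfl).symm⟩

/-- A function on the block, extended to the chain with period `11`. -/
def chainCol (φ : Fin 20 → ℤ) (u : Fin (m + 1) × Fin 20) : ℤ := 11 * (u.1.val : ℤ) + φ u.2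

lemma abs_chainCol_sub_le {φ : Fin 20 → ℤ}
    (hφ : ∀ k l, blockAdj k l = true → φ k - φ l ≤ 1) (h₀ : φ 0 = 0) (h₁ : φ 19 = 10)
    (u v : Fin (m + 1) × Fin 20) :
    |chainCol φ u - chainCol φ v| ≤ (sunChain m).dist u v := by
  refine abs_sub_le_dist_of_lipschitz sunChain_connected _ ?_ u v
  rintro ⟨i, k⟩ ⟨j, l⟩ (⟨h, h'⟩ | ⟨h, h', h''⟩ | ⟨h, h', h''⟩) <;>
    simp only [chainCol] at * <;> subst_vars
  · linarith [hφ k l h']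
  · rw [h₀, h₁]; omega
  · rw [h₀, h₁]; omega

/-- Every ball of positive radius misses the tip of some column in its range. -/
lemma exists_column_avoided (v : Fin (m + 1) × Fin 20) (r : ℕ) (hr : 1 ≤ r) :
    ∃ e : ℤ, |e| ≤ r ∧ ∀ u : Fin (m + 1) × Fin 20, blockTip u.2 = true →
      (sunChain m).dist u v ≤ r → chainCol blockCol u ≠ chainCol blockCol v + e := by
  have link : ∀ c : ℤ, c = 3 ∨ c = 7 → ∀ u : Fin (m + 1) × Fin 20, blockTip u.2 = true →
      chainCol blockCol u ≠ chainCol blockCol v + (c - blockCol v.2) := by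
    rintro c hc ⟨i, k⟩ hu h
    simp only [chainCol] at h hu
    have := blockCol_bounds k
    have := blockCol_tip_ne k hu
    omega
  obtain rfl | rfl | hr : r = 1 ∨ r = 2 ∨ 3 ≤ r := by omega
  · refine ⟨blockGap v.2, by simpa using abs_blockGap_le v.2, ?_⟩
    intro u hu hd h
    rcases eq_or_adj_of_dist_le_one sunChain_connected hd with rfl | ha
    · exact blockGap_ne_zero_of_tip _ hu (by linarith)
    · rcases ha with ⟨h', ha⟩ | ⟨h', hu', hv'⟩ | ⟨h', hv', hu'⟩
      · rw [chainCol, chainCol, h'] at h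
        exact blockCol_ne_add_blockGap _ _ hu ha (by linarith)
      · rw [chainCol, chainCol, hu', hv', show blockCol 19 = 10 from rfl,
          show blockCol 0 = 0 from rfl, show blockGap 0 = 1 from rfl] at h
        omega
      · rw [chainCol, chainCol, hu', hv', show blockCol 19 = 10 from rfl,
          show blockCol 0 = 0 from rfl, show blockGap 19 = -1 from rfl] at h
        omega
  · by_cases h₀ : v.2 = 0
    · refine ⟨-2, by norm_num, ?_⟩
      intro u hu hd h
      have hb := blockCol_bounds u.2
      have hL := abs_chainCol_sub_le blockColLeft_lipschitz rfl rfl u v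
      rw [abs_le] at hL
      simp only [chainCol, h₀, show blockCol 0 = 0 from rfl,
        show blockColLeft 0 = 0 from rfl] at h hL
      have := blockColLeft_eq_of_tip u.2 hu (by omega)
      omega
    by_cases h₁ : v.2 = 19
    · refine ⟨2, by norm_num, ?_⟩
      intro u hu hd h
      have hb := blockCol_bounds u.2
      have hL := abs_chainCol_sub_le blockColRight_lipschitz rfl rfl u v
      rw [abs_le] at hL
      simp only [chainCol, h₁, show blockCol 19 = 10 from rfl,
        show blockColRight 19 = 10 from rfl] at h hL
      have := blockColRight_eq_of_tip u.2 hu (by omega)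
      omega
    rcases exists_offset_le_two v.2 h₀ h₁ with h | h
    · exact ⟨_, h, fun u hu _ => link 3 (Or.inl rfl) u hu⟩
    · exact ⟨_, h, fun u hu _ => link 7 (Or.inr rfl) u hu⟩
  · have hr' : (3 : ℤ) ≤ r := by exact_mod_cast hr
    rcases exists_offset_le_three v.2 with h | h
    · exact ⟨_, h.trans hr', fun u hu _ => link 3 (Or.inl rfl) u hu⟩
    · exact ⟨_, h.trans hr', fun u hu _ => link 7 (Or.inr rfl) u hu⟩

/-- The tips of all suns of the chain. -/
def chainTips (m : ℕ) : Finset (Fin (m + 1) × Fin 20) :=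
  Finset.univ ×ˢ Finset.univ.filter fun k => blockTip k = true

lemma card_chainTips : (chainTips m).card = (m + 1) * 9 := by
  have : (Finset.univ.filter fun k => blockTip k = true).card = 9 := by decide
  rw [chainTips, Finset.card_product, this, Finset.card_univ, Fintype.card_fin]

lemma mem_chainTips {u : Fin (m + 1) × Fin 20} : u ∈ chainTips m ↔ blockTip u.2 = true := by
  simp [chainTips]

lemma card_chainTips_ball_le (v : Fin (m + 1) × Fin 20) (r : ℕ) (hr : 1 ≤ r) :
    ((chainTips m).filter fun u => (sunChain m).dist u v ≤ r).card ≤ 2 * r := by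
  obtain ⟨e, he, hav⟩ := exists_column_avoided v r hr
  set c := chainCol blockCol v
  have hcard : ((Finset.Icc (c - r) (c + r)).erase (c + e)).card = 2 * r := by
    rw [abs_le] at he
    rw [Finset.card_erase_of_mem (Finset.mem_Icc.2 ⟨by linarith, by linarith⟩), Int.card_Icc]
    omega
  rw [← hcard]
  refine Finset.card_le_card_of_injOn (chainCol blockCol) ?_ ?_
  · intro u hu
    simp only [Finset.coe_filter, mem_chainTips, Set.mem_ofPred_eq] at hu
    have hd : ((sunChain m).dist u v : ℤ) ≤ r := by exact_mod_cast hu.2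
    have := abs_le.1 ((abs_chainCol_sub_le blockCol_lipschitz rfl rfl u v).trans hd)
    simp only [Finset.coe_erase, Finset.coe_Icc, Set.mem_sdiff, Set.mem_Icc,
      Set.mem_singleton_iff]
    exact ⟨⟨by linarith, by linarith⟩, hav u hu.1 hu.2⟩
  · rintro ⟨i, k⟩ hu ⟨j, l⟩ hv h
    simp only [Finset.coe_filter, mem_chainTips, Set.mem_ofPred_eq] at hu hv
    simp only [chainCol] at h
    have := blockCol_bounds k
    have := blockCol_bounds l
    have hkl := blockCol_injOn_tips k l hu.1 hv.1 (by omega)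
    exact Prod.ext (Fin.ext (by change i.val = j.val; omega)) hkl

lemma le_two_mul_broadcastDominationNumber_sunChain :
    (m + 1) * 9 ≤ 2 * broadcastDominationNumber (sunChain m) := by
  rw [← card_chainTips]
  exact card_le_two_mul_broadcastDominationNumber sunChain_connected _ card_chainTips_ball_le

lemma dist_le_one_of_blockAdj (i : Fin (m + 1)) {k l : Fin 20}
    (h : k = l ∨ blockAdj k l = true) : (sunChain m).dist (i, k) (i, l) ≤ 1 := by
  rcases h with rfl | h
  · simp
  · exact (SimpleGraph.dist_eq_one_iff_adj.2 (Or.inl ⟨rfl, h⟩)).le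

lemma IsMultipacking.card_outer_sun_le {M : Set (Fin (m + 1) × Fin 20)}
    (hM : IsMultipacking (sunChain m) M) (i : Fin (m + 1)) (S : Finset (Fin 20))
    (hS : (∀ k ∈ S, k.val < 6) ∨ ∀ k ∈ S, 14 ≤ k.val) (hSM : ∀ k ∈ S, (i, k) ∈ M) :
    S.card ≤ 1 := by
  refine Finset.card_le_one.2 fun k hk l hl => ?_
  obtain ⟨c, hkc, hlc⟩ := exists_common_blockAdj_of_lt k l
    (hS.imp (fun h => ⟨h k hk, h l hl⟩) fun h => ⟨h k hk, h l hl⟩)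
  have h := hM (i, c) 1 le_rfl
  rw [Set.ncard_le_one_iff] at h
  have := h ⟨hSM k hk, dist_le_one_of_blockAdj i hkc⟩ ⟨hSM l hl, dist_le_one_of_blockAdj i hlc⟩
  exact congrArg Prod.snd this

lemma IsMultipacking.card_inner_sun_le {M : Set (Fin (m + 1) × Fin 20)}
    (hM : IsMultipacking (sunChain m) M) (i : Fin (m + 1)) (S : Finset (Fin 20))
    (hS : ∀ k ∈ S, 6 ≤ k.val ∧ k.val < 14) (hSM : ∀ k ∈ S, (i, k) ∈ M) :
    S.card ≤ 2 := by
  refine le_trans ?_ (hM (i, 11) 2 one_le_two)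
  rw [← Set.ncard_coe_finset, ← Set.ncard_image_of_injective _ (Prod.mk_right_injective i)]
  refine Set.ncard_le_ncard ?_ (Set.toFinite _)
  rintro _ ⟨k, hk, rfl⟩
  obtain ⟨c, hkc, hc⟩ := exists_blockAdj_eleven k (hS k hk).1 (hS k hk).2
  refine ⟨hSM k hk, (sunChain_connected.dist_triangle (v := (i, c))).trans ?_⟩
  have := dist_le_one_of_blockAdj i hkc
  have := dist_le_one_of_blockAdj i hc
  omega

lemma multipackingNumber_sunChain_le : multipackingNumber (sunChain m) ≤ (m + 1) * 4 := by
  classical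
  refine multipackingNumber_le fun M hM => ?_
  set B : Fin (m + 1) → Finset (Fin 20) := fun i => Finset.univ.filter fun k => (i, k) ∈ M with hB
  have hMB : M = ((Finset.univ.biUnion fun i => (B i).image (Prod.mk i) : Finset _) : Set _) := by
    ext ⟨i, k⟩
    simp [hB]
  have hcard : ∀ i, ((B i).image (Prod.mk i)).card ≤ 4 := by
    intro i
    refine Finset.card_image_le.trans ?_
    have h₁ := hM.card_outer_sun_le i ((B i).filter fun k => k.val < 6)
      (Or.inl fun k hk => (Finset.mem_filter.1 hk).2) fun k hk => (Finset.mem_filter.1 (Finset.mem_filter.1 hk).1).2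
    have h₂ := hM.card_inner_sun_le i ((B i).filter fun k => 6 ≤ k.val ∧ k.val < 14)
      (fun k hk => (Finset.mem_filter.1 hk).2) fun k hk => (Finset.mem_filter.1 (Finset.mem_filter.1 hk).1).2
    have h₃ := hM.card_outer_sun_le i ((B i).filter fun k => 14 ≤ k.val)
      (Or.inr fun k hk => (Finset.mem_filter.1 hk).2) fun k hk => (Finset.mem_filter.1 (Finset.mem_filter.1 hk).1).2
    have hsub : B i ⊆ ((B i).filter fun k => k.val < 6) ∪
        ((B i).filter fun k => 6 ≤ k.val ∧ k.val < 14) ∪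
        ((B i).filter fun k => 14 ≤ k.val) := by
      intro k hk
      simp only [Finset.mem_union, Finset.mem_filter, hk, true_and]
      omega
    have h₄ := Finset.card_le_card hsub
    have h₅ := Finset.card_union_le (((B i).filter fun k => k.val < 6) ∪
        ((B i).filter fun k => 6 ≤ k.val ∧ k.val < 14)) ((B i).filter fun k => 14 ≤ k.val)
    have h₆ := Finset.card_union_le ((B i).filter fun k => k.val < 6)
        ((B i).filter fun k => 6 ≤ k.val ∧ k.val < 14)
    omega
  rw [hMB, Set.ncard_coe_finset]
  refine Finset.card_biUnion_le.trans ((Finset.sum_le_card_nsmul _ _ 4 fun i _ => hcard i).trans ?_)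
  simp

end Chain

/-- For every natural number N, there exists a finite connected chordal
graph G with γ_b(G) − MP(G) ≥ N. -/
theorem stmt4 (N : ℕ) :
    ∃ (V : Type) (G : SimpleGraph V), Finite V ∧ G.Connected ∧ IsChordal G ∧
      multipackingNumber G + N ≤ broadcastDominationNumber G := by
  refine ⟨Fin (2 * N + 1 + 1) × Fin 20, sunChain (2 * N + 1), inferInstance, sunChain_connected,
    sunChain_isChordal, ?_⟩
  have h₁ := multipackingNumber_sunChain_le (m := 2 * N + 1)
  have h₂ := le_two_mul_broadcastDominationNumber_sunChain (m := 2 * N + 1)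
  omega
end

section
/- For every positive integer k, there exists a finite connected chordal graph F_k such that MP(F_k) = 3k and γ_b(F_k) = 4k. -/
open SimpleGraph

variable {V : Type*}

theorem isChordal_of_perfectElimination (G : SimpleGraph V) (ρ : V → ℕ)
    (hρ : Function.Injective ρ)
    (h : ∀ v a b, G.Adj v a → G.Adj v b → ρ a < ρ v → ρ b < ρ v → a ≠ b → G.Adj a b) :
    IsChordal G := by
  rintro n hn ⟨f, hf⟩
  obtain ⟨m, rfl⟩ : ∃ m, n = m + 4 := ⟨n - 4, by omega⟩
  obtain ⟨i, hi⟩ := Finite.exists_max fun j => ρ (f j)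
  have hlt : ∀ j, j ≠ i → ρ (f j) < ρ (f i) := fun j hj =>
    lt_of_le_of_ne (hi j) fun e => hj (f.injective (hρ e))
  have h1 : (1 : Fin (m + 4)) ≠ 0 := by simp
  have h2 : (1 : Fin (m + 4)) + 1 ≠ 0 := by
    simp [Fin.ext_iff, Fin.val_add, Nat.mod_eq_of_lt]
  have h3 : (1 : Fin (m + 4)) + 1 + 1 ≠ 0 := by
    simp [Fin.ext_iff, Fin.val_add, Nat.mod_eq_of_lt]
  have hadj := h (f i) (f (i + 1)) (f (i - 1))
    ((hf _ _).2 (by rw [cycleGraph_adj]; right; abel))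
    ((hf _ _).2 (by rw [cycleGraph_adj]; left; abel))
    (hlt _ fun e => h1 (by simp at e))
    (hlt _ fun e => h1 (by simp at e))
    (fun e => h2 (by
      have e' := f.injective e
      calc (1 : Fin (m + 4)) + 1 = (i + 1) - (i - 1) := by abel
        _ = 0 := by rw [e', sub_self]))
  rw [hf, cycleGraph_adj] at hadj
  rcases hadj with e | e
  · apply h1
    calc (1 : Fin (m + 4)) = (i + 1 - (i - 1)) - 1 := by abel
      _ = 0 := by rw [e, sub_self]
  · apply h3
    calc (1 : Fin (m + 4)) + 1 + 1 = 1 - (i - 1 - (i + 1)) := by abel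
      _ = 0 := by rw [e, sub_self]

theorem le_add_dist_of_adj {G : SimpleGraph V} (hG : G.Connected) (g : V → ℤ)
    (hg : ∀ u v, G.Adj u v → g u ≤ g v + 1) (u v : V) : g u ≤ g v + G.dist u v := by
  obtain ⟨p, hp⟩ := hG.exists_walk_length_eq_dist u v
  rw [← hp]
  clear hp
  induction p with
  | nil => simp
  | cons h p ih =>
    have := hg _ _ h
    rw [Walk.length_cons]
    push_cast
    linarith

theorem dist_le_one_of_eq_or_adj {G : SimpleGraph V} {u v : V} (h : u = v ∨ G.Adj u v) :
    G.dist u v ≤ 1 := by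
  rcases h with rfl | h
  · simp
  · exact (dist_eq_one_iff_adj.2 h).le

/-- Linear programming duality: a `c`-fold fractional multipacking bounds the cost of every
dominating broadcast from below. -/
theorem sum_weight_le_mul_cost [Fintype V] {G : SimpleGraph V} (w : V → ℕ) (c : ℕ)
    (hw : ∀ v r, 1 ≤ r → (∑ u, if G.dist u v ≤ r then w u else 0) ≤ c * r)
    {f : V → ℕ} (hf : IsDominatingBroadcast G f) : ∑ u, w u ≤ c * ∑ v, f v := by
  classical
  calc ∑ u, w u ≤ ∑ u, ∑ v, if 0 < f v ∧ G.dist u v ≤ f v then w u else 0 := by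
        refine Finset.sum_le_sum fun u _ => ?_
        obtain ⟨v, hv⟩ := hf.2 u
        calc w u = if 0 < f v ∧ G.dist u v ≤ f v then w u else 0 := (if_pos hv).symm
          _ ≤ _ := Finset.single_le_sum
            (f := fun v => if 0 < f v ∧ G.dist u v ≤ f v then w u else 0)
            (fun _ _ => Nat.zero_le _) (Finset.mem_univ v)
    _ = ∑ v, ∑ u, if 0 < f v ∧ G.dist u v ≤ f v then w u else 0 := Finset.sum_comm
    _ ≤ ∑ v, c * f v := by
        refine Finset.sum_le_sum fun v _ => ?_
        rcases Nat.eq_zero_or_pos (f v) with h | h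
        · simp [h]
        · simpa [h] using hw v (f v) h
    _ = c * ∑ v, f v := by rw [Finset.mul_sum]

theorem card_filter_nine_mul_add_le {k : ℕ} (P : Fin k → Prop) [DecidablePred P] (L R o : ℤ)
    (hLR : L ≤ R + 1) (hP : ∀ m, P m → L ≤ 9 * (m : ℤ) + o ∧ 9 * (m : ℤ) + o ≤ R) :
    ((∑ m, if P m then 1 else 0 : ℕ) : ℤ) ≤ (R - o) / 9 - (L - 1 - o) / 9 := by
  have hcard : (Finset.univ.filter P).card ≤
      (Finset.Ioc ((L - 1 - o) / 9) ((R - o) / 9)).card := by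
    refine Finset.card_le_card_of_injOn (fun m => (m : ℤ)) (fun m hm => ?_)
      (fun a _ b _ e => Fin.ext (Int.ofNat_inj.1 e))
    have := hP m (by simpa using hm)
    simp only [Finset.coe_Ioc, Set.mem_Ioc]
    omega
  rw [Int.card_Ioc] at hcard
  rw [Finset.card_filter] at hcard
  omega

theorem floor_sum_upper (q a : ℤ) (h0 : 0 ≤ a) (h9 : a < 9) :
    (9 * q + a) / 9 + 2 * ((9 * q + a - 2) / 9) + (9 * q + a - 3) / 9 +
      2 * ((9 * q + a - 5) / 9) + 2 * ((9 * q + a - 8) / 9) = 8 * q +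
        if a < 2 then -7 else if a < 3 then -5 else if a < 5 then -4 else
          if a < 8 then -2 else 0 := by
  interval_cases a <;> simp <;> omega

theorem floor_sum_lower (q a : ℤ) (h0 : 0 ≤ a) (h9 : a < 9) :
    2 * ((9 * q + a) / 9) + (9 * q + a - 2) / 9 + 2 * ((9 * q + a - 3) / 9) +
      (9 * q + a - 5) / 9 + 2 * ((9 * q + a - 6) / 9) = 8 * q +
        if a < 2 then -6 else if a < 3 then -5 else if a < 5 then -3 else
          if a < 6 then -2 else 0 := by
  interval_cases a <;> simp <;> omega

theorem floor_sum_le {x y : ℤ} (h : y + 5 ≤ x ∨ x = y + 3 ∧ x % 9 ≠ 2 ∧ x % 9 ≠ 5)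
    (hodd : (x - y) % 2 = 1) :
    x / 9 + 2 * ((x - 2) / 9) + (x - 3) / 9 + 2 * ((x - 5) / 9) + 2 * ((x - 8) / 9) ≤
      2 * (y / 9) + (y - 2) / 9 + 2 * ((y - 3) / 9) + (y - 5) / 9 + 2 * ((y - 6) / 9) +
        (x - y - 1) := by
  obtain ⟨p, a, rfl, ha, ha'⟩ : ∃ q a : ℤ, x = 9 * q + a ∧ 0 ≤ a ∧ a < 9 :=
    ⟨x / 9, x % 9, by omega, by omega, by omega⟩
  obtain ⟨q, b, rfl, hb, hb'⟩ : ∃ q a : ℤ, y = 9 * q + a ∧ 0 ≤ a ∧ a < 9 :=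
    ⟨y / 9, y % 9, by omega, by omega, by omega⟩
  rw [floor_sum_upper p a ha ha', floor_sum_lower q b hb hb']
  split_ifs <;> omega

/-- Vertices of the chain of `3 * k` six-vertex units: `(m, t, i)` is vertex `i` of unit
`3 * m + t`. -/
abbrev SunChainVertex (k : ℕ) := Fin k × Fin 3 × Fin 6

namespace SunChain

variable {k : ℕ}

/-- Adjacency inside a unit: the square of the path `0, 1, 2, 3, 4`, together with a vertex `5`
joined to `1` and `3`, and also to `2` in units with `t = 2`. For `t ≠ 2` this is the 3-sun with
ears `0`, `4`, `5`. -/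
def UnitAdj (t : Fin 3) (i j : Fin 6) : Prop :=
  i ≠ j ∧ ((i.val ≤ 4 ∧ j.val ≤ 4 ∧ i.val ≤ j.val + 2 ∧ j.val ≤ i.val + 2) ∨
    (i = 5 ∧ (j = 1 ∨ j = 3 ∨ (t = 2 ∧ j = 2))) ∨ (j = 5 ∧ (i = 1 ∨ i = 3 ∨ (t = 2 ∧ i = 2))))

instance (t : Fin 3) (i j : Fin 6) : Decidable (UnitAdj t i j) := by
  unfold UnitAdj; infer_instance

/-- The index of the unit containing a vertex. -/
def unit (v : SunChainVertex k) : ℕ := 3 * v.1 + v.2.1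

/-- Offset inside a unit of the projection to the spine. -/
def offset (i : Fin 6) : ℕ := if i = 0 then 0 else if i = 4 then 2 else 1

/-- The projection to the spine, a path on `9 * k` vertices. -/
def pos (v : SunChainVertex k) : ℕ := 3 * unit v + offset v.2.2

/-- Vertex `4` of a unit precedes vertex `0` of the next unit. -/
def Link (v w : SunChainVertex k) : Prop := unit v + 1 = unit w ∧ v.2.2 = 4 ∧ w.2.2 = 0

/-- The chain of units, consecutive units being joined by an edge. -/
def graph (k : ℕ) : SimpleGraph (SunChainVertex k) where
  Adj v w := (v.1 = w.1 ∧ v.2.1 = w.2.1 ∧ UnitAdj v.2.1 v.2.2 w.2.2) ∨ Link v w ∨ Link w v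
  symm := ⟨by
    have hsymm : ∀ t i j, UnitAdj t i j → UnitAdj t j i := by decide
    rintro v w (⟨h1, h2, h3⟩ | h | h)
    · exact Or.inl ⟨h1.symm, h2.symm, h2 ▸ hsymm _ _ _ h3⟩
    · exact Or.inr (Or.inr h)
    · exact Or.inr (Or.inl h)⟩
  loopless := ⟨by
    rintro v (h | h | h)
    · exact h.2.2.1 rfl
    · exact absurd h.1 (by simp)
    · exact absurd h.1 (by simp)⟩

theorem adj_iff {v w : SunChainVertex k} : (graph k).Adj v w ↔
    (v.1 = w.1 ∧ v.2.1 = w.2.1 ∧ UnitAdj v.2.1 v.2.2 w.2.2) ∨ Link v w ∨ Link w v := Iff.rfl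

theorem eq_of_unit_eq {v w : SunChainVertex k} (h : unit v = unit w) :
    v.1 = w.1 ∧ v.2.1 = w.2.1 := by
  unfold unit at h
  have := v.2.1.isLt
  have := w.2.1.isLt
  exact ⟨Fin.ext (by omega), Fin.ext (by omega)⟩

theorem ext_unit {v w : SunChainVertex k} (h : unit v = unit w) (h' : v.2.2 = w.2.2) : v = w :=
  Prod.ext (eq_of_unit_eq h).1 (Prod.ext (eq_of_unit_eq h).2 h')

theorem unit_lt (v : SunChainVertex k) : unit v < 3 * k := by
  have := v.1.isLt
  have := v.2.1.isLt
  unfold unit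
  omega

/-- The position of a vertex in a perfect elimination ordering. -/
def rank (v : SunChainVertex k) : ℕ := 6 * unit v + v.2.2

theorem rank_injective : Function.Injective (rank (k := k)) := by
  intro v w h
  have := v.2.2.isLt
  have := w.2.2.isLt
  unfold rank at h
  exact ext_unit (by omega) (Fin.ext (by omega))

theorem earlier_neighbor {v a : SunChainVertex k} (h : (graph k).Adj v a) (hr : rank a < rank v) :
    (v.1 = a.1 ∧ v.2.1 = a.2.1 ∧ UnitAdj v.2.1 v.2.2 a.2.2 ∧ a.2.2 < v.2.2) ∨ Link a v := by
  rcases adj_iff.1 h with ⟨h1, h2, h3⟩ | h | h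
  · refine Or.inl ⟨h1, h2, h3, ?_⟩
    simp only [rank, unit, h1, h2] at hr
    exact Fin.lt_def.2 (by omega)
  · have := h.1
    have := v.2.2.isLt
    have := a.2.2.isLt
    unfold rank at hr
    omega
  · exact Or.inr h

theorem isChordal_graph (k : ℕ) : IsChordal (graph k) := by
  refine isChordal_of_perfectElimination _ rank rank_injective fun v a b ha hb hra hrb hab => ?_
  have hclique : ∀ t i j l, UnitAdj t i j → UnitAdj t i l → j < i → l < i → j ≠ l →
      UnitAdj t j l := by decide
  have hne : ∀ i : Fin 6, ¬ i < 0 := by decide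
  rcases earlier_neighbor ha hra with ⟨h1, h2, h3, h4⟩ | h
  · rcases earlier_neighbor hb hrb with ⟨h1', h2', h3', h4'⟩ | h'
    · refine adj_iff.2 (Or.inl ⟨h1.symm.trans h1', h2.symm.trans h2', ?_⟩)
      rw [← h2]
      refine hclique _ _ _ _ h3 h3' h4 h4' fun e => hab ?_
      exact Prod.ext (h1.symm.trans h1') (Prod.ext (h2.symm.trans h2') e)
    · exact absurd (h'.2.2 ▸ h4) (hne _)
  · rcases earlier_neighbor hb hrb with ⟨h1', h2', h3', h4'⟩ | h'
    · exact absurd (h.2.2 ▸ h4') (hne _)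
    · exact absurd (ext_unit (by have := h.1; have := h'.1; omega) (h.2.1.trans h'.2.1.symm)) hab

theorem exists_unit_eq {n : ℕ} (hn : n < 3 * k) (i : Fin 6) :
    ∃ v : SunChainVertex k, unit v = n ∧ v.2.2 = i :=
  ⟨(⟨n / 3, by omega⟩, ⟨n % 3, by omega⟩, i), by simp only [unit]; omega, rfl⟩

theorem exists_common_neighbor {v w : SunChainVertex k} (h : unit v = unit w) :
    ∃ z, (v = z ∨ (graph k).Adj v z) ∧ (w = z ∨ (graph k).Adj w z) := by
  obtain ⟨h1, h2⟩ := eq_of_unit_eq h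
  have hcommon : ∀ t i j, ∃ l, (i = l ∨ UnitAdj t i l) ∧ (j = l ∨ UnitAdj t j l) := by decide
  obtain ⟨l, hi, hj⟩ := hcommon v.2.1 v.2.2 w.2.2
  refine ⟨(v.1, v.2.1, l), ?_, ?_⟩
  · exact hi.imp (fun e => Prod.ext rfl (Prod.ext rfl e)) fun e => Or.inl ⟨rfl, rfl, e⟩
  · exact hj.imp (fun e => Prod.ext h1.symm (Prod.ext h2.symm e))
      fun e => Or.inl ⟨h1.symm, h2.symm, h2 ▸ e⟩

theorem connected_graph (hk : 0 < k) : (graph k).Connected := by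
  have hunit : ∀ v w : SunChainVertex k, unit v = unit w → (graph k).Reachable v w := by
    intro v w h
    obtain ⟨z, hv, hw⟩ := exists_common_neighbor h
    have aux : ∀ {x : SunChainVertex k}, (x = z ∨ (graph k).Adj x z) → (graph k).Reachable x z :=
      fun {x} hx => by
        rcases hx with rfl | hx
        · exact Reachable.refl _
        · exact hx.reachable
    exact (aux hv).trans (aux hw).symm
  have hroot : ∀ n, ∀ v : SunChainVertex k, unit v = n →
      (graph k).Reachable v (⟨0, hk⟩, 0, 0) := by
    intro n
    induction n with
    | zero => exact fun v hv => hunit _ _ (by rw [hv]; simp [unit])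
    | succ n ih =>
      intro v hv
      have := unit_lt v
      obtain ⟨a, ha, ha'⟩ := exists_unit_eq (k := k) (n := n + 1) (by omega) 0
      obtain ⟨c, hc, hc'⟩ := exists_unit_eq (k := k) (n := n) (by omega) 4
      have hac : (graph k).Adj a c := Or.inr (Or.inr ⟨by omega, hc', ha'⟩)
      exact ((hunit v a (by omega)).trans hac.reachable).trans (ih c hc)
  have : Nonempty (SunChainVertex k) := ⟨(⟨0, hk⟩, 0, 0)⟩
  exact ⟨fun v w => (hroot _ v rfl).trans (hroot _ w rfl).symm⟩

theorem dist_le_two (hk : 0 < k) {v w : SunChainVertex k} (h : unit v = unit w) :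
    (graph k).dist v w ≤ 2 := by
  obtain ⟨z, hv, hw⟩ := exists_common_neighbor h
  have h1 := dist_le_one_of_eq_or_adj hv
  have h2 := dist_le_one_of_eq_or_adj hw
  have h3 := (connected_graph hk).dist_triangle (u := v) (v := z) (w := w)
  rw [(graph k).dist_comm (u := z)] at h3
  omega

theorem pos_le_of_adj {v w : SunChainVertex k} (h : (graph k).Adj v w) : pos v ≤ pos w + 1 := by
  have hoff : ∀ t i j, UnitAdj t i j → offset i ≤ offset j + 1 := by decide
  have h0 : offset 0 = 0 := rfl
  have h4 : offset 4 = 2 := rfl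
  rcases adj_iff.1 h with ⟨h1, h2, h3⟩ | ⟨h1, h2, h3⟩ | ⟨h1, h2, h3⟩
  · have := hoff _ _ _ h3
    simp only [pos, unit, h1, h2]
    omega
  all_goals
    simp only [pos, h2, h3, h0, h4]
    omega

theorem abs_pos_sub_le_dist (hk : 0 < k) (v w : SunChainVertex k) :
    |(pos v : ℤ) - pos w| ≤ (graph k).dist v w := by
  have key : ∀ x y : SunChainVertex k, (pos x : ℤ) ≤ pos y + (graph k).dist x y :=
    le_add_dist_of_adj (connected_graph hk) (fun v => (pos v : ℤ))
      fun u v h => by exact_mod_cast pos_le_of_adj h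
  have h1 := key v w
  have h2 := key w v
  rw [(graph k).dist_comm] at h2
  rw [abs_le]
  constructor <;> linarith

theorem abs_pos_sub_succ_le_dist (hk : 0 < k) {v w : SunChainVertex k} (hv : v.2.2 = 5)
    (hvw : w ≠ v) : |(pos v : ℤ) - pos w| + 1 ≤ (graph k).dist v w := by
  have h := le_add_dist_of_adj (connected_graph hk)
    (fun x => if x = v then 0 else |(pos v : ℤ) - pos x| + 1) (fun x y hxy => ?_) w v
  · rw [(graph k).dist_comm]
    simpa [hvw] using h
  have h1 := pos_le_of_adj hxy
  have h2 := pos_le_of_adj hxy.symm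
  by_cases hy : y = v
  · subst hy
    have hoff : ∀ t i, UnitAdj t i 5 → offset i = 1 := by decide
    have hpos : pos x = pos y := by
      rcases adj_iff.1 hxy with ⟨h1, h2, h3⟩ | ⟨-, -, h3⟩ | ⟨-, h3, -⟩
      · rw [hv] at h3
        simp only [pos, unit, h1, h2, hv, hoff _ _ h3]
        rfl
      all_goals exact absurd (hv.symm.trans h3) (by decide)
    simp [hxy.ne, hpos]
  · by_cases hx : x = v
    · simp only [hx, hy, if_true, if_false]
      positivity
    · simp only [hx, hy, if_false]
      have h3 := abs_sub_le (pos v : ℤ) (pos y) (pos x)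
      have h4 : |(pos y : ℤ) - pos x| ≤ 1 := by rw [abs_le]; constructor <;> omega
      linarith

theorem ncard_le_of_isMultipacking {M : Set (SunChainVertex k)}
    (hM : IsMultipacking (graph k) M) : M.ncard ≤ 3 * k := by
  have hinj : Set.InjOn unit M := by
    intro v hv w hw h
    obtain ⟨z, hvz, hwz⟩ := exists_common_neighbor h
    have hle := hM z 1 le_rfl
    rw [Set.ncard_le_one (Set.toFinite _)] at hle
    exact hle v ⟨hv, dist_le_one_of_eq_or_adj hvz⟩ w ⟨hw, dist_le_one_of_eq_or_adj hwz⟩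
  calc M.ncard ≤ (Set.Iio (3 * k)).ncard :=
        Set.ncard_le_ncard_of_injOn unit (fun v _ => unit_lt v) hinj (Set.finite_Iio _)
    _ = 3 * k := by rw [← Finset.coe_Iio, Set.ncard_coe_finset, Nat.card_Iio]

theorem isMultipacking_spine (hk : 0 < k) :
    IsMultipacking (graph k) {v | v.2.2 = 2} := by
  intro v r hr
  have hsub : ∀ u ∈ {u : SunChainVertex k | u.2.2 = 2} ∩ {u | (graph k).dist u v ≤ r},
      unit u ∈ Set.Ico ((pos v + 1 - r) / 3) ((pos v + 1 - r) / 3 + r) := by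
    rintro u ⟨hu, hd⟩
    have h := abs_le.1 ((abs_pos_sub_le_dist hk u v).trans (Int.ofNat_le.2 hd))
    have hpu : pos u = 3 * unit u + 1 := by
      rw [pos, show u.2.2 = 2 from hu]; rfl
    rw [hpu] at h
    push_cast at h
    rw [Set.mem_Ico]
    omega
  have hle := Set.ncard_le_ncard_of_injOn unit hsub
    (fun a ha b hb e => ext_unit e (ha.1.trans hb.1.symm)) (Set.finite_Ico _ _)
  rw [← Finset.coe_Ico, Set.ncard_coe_finset, Nat.card_Ico] at hle
  omega

theorem multipackingNumber_graph (hk : 0 < k) : multipackingNumber (graph k) = 3 * k := by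
  refine IsGreatest.csSup_eq ⟨⟨_, isMultipacking_spine hk, ?_⟩, ?_⟩
  · have hrange : {v : SunChainVertex k | v.2.2 = 2} =
        Set.range fun p : Fin k × Fin 3 => ((p.1, p.2, 2) : SunChainVertex k) := by
      ext ⟨m, t, i⟩
      simp [eq_comm]
    rw [hrange, ← Set.image_univ, Set.ncard_image_of_injective, Set.ncard_univ]
    · simp [mul_comm]
    · rintro ⟨a, b⟩ ⟨c, d⟩ h
      simp only [Prod.mk.injEq] at h
      simp [h.1, h.2.1]
  · rintro _ ⟨M, hM, rfl⟩
    exact ncard_le_of_isMultipacking hM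

theorem four_le_gDiam (hk : 0 < k) : 4 ≤ gDiam (graph k) := by
  have h := abs_pos_sub_le_dist hk (⟨0, hk⟩, 2, 0) (⟨0, hk⟩, 0, 0)
  have h2 : pos ((⟨0, hk⟩, 2, 0) : SunChainVertex k) = 6 := rfl
  have h0 : pos ((⟨0, hk⟩, 0, 0) : SunChainVertex k) = 0 := rfl
  have hle : (graph k).dist (⟨0, hk⟩, 2, 0) (⟨0, hk⟩, 0, 0) ≤ gDiam (graph k) :=
    le_csSup (Set.toFinite _).bddAbove ⟨(_, _), rfl⟩
  rw [h2, h0] at h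
  have h' := (le_abs_self _).trans h
  omega

/-- The broadcast of strength `4` at the centre of every block of three units. -/
def blockBroadcast (v : SunChainVertex k) : ℕ := if v.2 = (1, 2) then 4 else 0

theorem dist_center_le_four (hk : 0 < k) (v : SunChainVertex k) :
    (graph k).dist v (v.1, 1, 2) ≤ 4 := by
  have htri : ∀ x y z, (graph k).dist x z ≤ (graph k).dist x y + (graph k).dist y z :=
    fun x y z => (connected_graph hk).dist_triangle
  obtain ⟨m, t, i⟩ := v
  have hstep : ∀ x y : SunChainVertex k, unit (m, t, i) = unit x → (graph k).Adj x y →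
      (graph k).Adj y (m, 1, 2) → (graph k).dist (m, t, i) (m, 1, 2) ≤ 4 := by
    intro x y hu hxy hy
    have h1 := dist_le_two hk hu
    have h2 := dist_eq_one_iff_adj.2 hxy
    have h3 := dist_eq_one_iff_adj.2 hy
    have h4 := htri (m, t, i) x (m, 1, 2)
    have h5 := htri x y (m, 1, 2)
    omega
  have hadj : UnitAdj 1 0 2 ∧ UnitAdj 1 4 2 := by decide
  fin_cases t
  · exact hstep (m, 0, 4) (m, 1, 0) rfl (Or.inr (Or.inl ⟨rfl, rfl, rfl⟩))
      (Or.inl ⟨rfl, rfl, hadj.1⟩)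
  · exact (dist_le_two hk (v := (m, 1, i)) (w := (m, 1, 2)) rfl).trans (by norm_num : 2 ≤ 4)
  · exact hstep (m, 2, 0) (m, 1, 4) rfl (Or.inr (Or.inr ⟨rfl, rfl, rfl⟩))
      (Or.inl ⟨rfl, rfl, hadj.2⟩)

theorem isDominatingBroadcast_blockBroadcast (hk : 0 < k) :
    IsDominatingBroadcast (graph k) blockBroadcast := by
  refine ⟨fun v => ?_, fun u => ⟨(u.1, 1, 2), ?_, ?_⟩⟩
  · have := four_le_gDiam hk
    unfold blockBroadcast
    split_ifs <;> omega
  · simp [blockBroadcast]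
  · simpa [blockBroadcast] using dist_center_le_four hk u

theorem sum_blockBroadcast : ∑ v : SunChainVertex k, blockBroadcast v = 4 * k := by
  simp [blockBroadcast, Fintype.sum_prod_type, mul_comm]

/-- Twice a fractional multipacking of total weight `4 * k`. -/
def weight (v : SunChainVertex k) : ℕ :=
  if v.2 ∈ ({(0, 0), (0, 4), (0, 5), (1, 0), (1, 4), (1, 5)} : Finset (Fin 3 × Fin 6)) then 1
  else if v.2 = (2, 5) then 2 else 0

theorem sum_weight : ∑ v : SunChainVertex k, weight v = 8 * k := by
  have h : ∑ p : Fin 3 × Fin 6, (if p ∈ ({(0, 0), (0, 4), (0, 5), (1, 0), (1, 4), (1, 5)} :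
      Finset (Fin 3 × Fin 6)) then 1 else if p = (2, 5) then 2 else 0) = 8 := by decide
  rw [Fintype.sum_prod_type]
  simp only [weight, h]
  simp [mul_comm]

/-- The number of copies of a vertex of the block in a ball. -/
noncomputable def ballCount (v : SunChainVertex k) (r : ℕ) (t : Fin 3) (i : Fin 6) : ℕ :=
  ∑ m, if (graph k).dist (m, t, i) v ≤ r then 1 else 0

theorem sum_weight_ball_eq (v : SunChainVertex k) (r : ℕ) :
    (∑ u, if (graph k).dist u v ≤ r then weight u else 0) =
      ballCount v r 0 0 + ballCount v r 0 4 + ballCount v r 0 5 +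
      ballCount v r 1 0 + ballCount v r 1 4 + ballCount v r 1 5 + 2 * ballCount v r 2 5 := by
  simp only [ballCount, Finset.mul_sum, ← Finset.sum_add_distrib]
  rw [Fintype.sum_prod_type]
  refine Finset.sum_congr rfl fun m _ => ?_
  simp [weight, Fintype.sum_prod_type, Fin.sum_univ_succ]
  ring

theorem ballCount_le (hk : 0 < k) (v : SunChainVertex k) (r : ℕ) (t : Fin 3) (i : Fin 6)
    {x y o : ℤ} (hx : x = pos v + r) (hy : y = pos v - r - 1) (ho : o = 3 * t.val + offset i) :
    (ballCount v r t i : ℤ) ≤ (x - o) / 9 - (y - o) / 9 := by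
  have h := card_filter_nine_mul_add_le (k := k) (fun m => (graph k).dist (m, t, i) v ≤ r)
    (y + 1) x o (by omega) fun m hm => ?_
  · rwa [add_sub_cancel_right] at h
  have h := abs_le.1 ((abs_pos_sub_le_dist hk (m, t, i) v).trans (Int.ofNat_le.2 hm))
  simp only [pos, unit] at h hx hy
  push_cast at h hx hy
  omega

theorem ballCount_five_le (hk : 0 < k) (v : SunChainVertex k) {r : ℕ} (hr : 1 ≤ r) (t : Fin 3)
    {x y o : ℤ} (hx : x = pos v + r) (hy : y = pos v - r - 1) (ho : o = 3 * t.val) :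
    (ballCount v r t 5 : ℤ) ≤ (x - (o + 2)) / 9 - (y - o) / 9 := by
  have h := card_filter_nine_mul_add_le (k := k) (fun m => (graph k).dist (m, t, 5) v ≤ r)
    (y + 2) (x - 1) (o + 1) (by omega) fun m hm => ?_
  · rwa [show x - 1 - (o + 1) = x - (o + 2) by ring,
      show y + 2 - 1 - (o + 1) = y - o by ring] at h
  have hp : pos (m, t, 5) = 3 * unit (m, t, 5) + 1 := rfl
  by_cases hv : v = (m, t, 5)
  · rw [hv, hp] at hx hy
    simp only [unit] at hx hy
    push_cast at hx hy
    omega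
  · have h := (abs_pos_sub_succ_le_dist hk (v := (m, t, 5)) rfl hv).trans (Int.ofNat_le.2 hm)
    rw [← le_sub_iff_add_le, abs_le, hp] at h
    simp only [unit] at h
    push_cast at h
    omega

theorem ballCount_one_eq_zero (hk : 0 < k) {v : SunChainVertex k} {t : Fin 3} {i : Fin 6}
    (hne : v.2.2 ≠ i) (hunit : ¬ UnitAdj t i v.2.2) (hlink : ¬ (i = 4 ∧ v.2.2 = 0))
    (hlink' : ¬ (i = 0 ∧ v.2.2 = 4)) : ballCount v 1 t i = 0 := by
  refine Finset.sum_eq_zero fun m _ => if_neg fun hle => ?_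
  rcases Nat.le_one_iff_eq_zero_or_eq_one.1 hle with h | h
  · rw [(connected_graph hk).dist_eq_zero_iff] at h
    exact hne (h ▸ rfl)
  · rcases adj_iff.1 (dist_eq_one_iff_adj.1 h) with h | h | h
    · exact hunit h.2.2
    · exact hlink h.2
    · exact hlink' ⟨h.2.2, h.2.1⟩

theorem sum_weight_ball_le (hk : 0 < k) (v : SunChainVertex k) (r : ℕ) (hr : 1 ≤ r) :
    (∑ u, if (graph k).dist u v ≤ r then weight u else 0) ≤ 2 * r := by
  rw [sum_weight_ball_eq]
  obtain ⟨x, hx⟩ : ∃ x : ℤ, x = pos v + r := ⟨_, rfl⟩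
  obtain ⟨y, hy⟩ : ∃ y : ℤ, y = pos v - r - 1 := ⟨_, rfl⟩
  have b00 := ballCount_le hk v r 0 0 hx hy (o := 0) rfl
  have b04 := ballCount_le hk v r 0 4 hx hy (o := 2) rfl
  have b10 := ballCount_le hk v r 1 0 hx hy (o := 3) rfl
  have b14 := ballCount_le hk v r 1 4 hx hy (o := 5) rfl
  have b05 := ballCount_five_le hk v hr 0 hx hy (o := 0) rfl
  have b15 := ballCount_five_le hk v hr 1 hx hy (o := 3) rfl
  have b25 := ballCount_five_le hk v hr 2 hx hy (o := 6) rfl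
  norm_num only [sub_zero] at b00 b05 b15 b25
  have hsun : r = 1 → pos v % 9 = 1 ∨ pos v % 9 = 4 →
      (ballCount v 1 0 0 = 0 ∧ ballCount v 1 1 0 = 0) ∨
      (ballCount v 1 0 4 = 0 ∧ ballCount v 1 1 4 = 0) ∨
      (ballCount v 1 0 5 = 0 ∧ ballCount v 1 1 5 = 0) := by
    rintro rfl h
    have hcases : ∀ i, offset i ≤ 2 ∧ (offset i = 1 → i = 1 ∨ i = 2 ∨ i = 3 ∨ i = 5) := by decide
    have hoff : offset v.2.2 = 1 := by
      have := (hcases v.2.2).1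
      unfold pos at h
      omega
    have hzero := fun t i => ballCount_one_eq_zero (k := k) hk (v := v) (t := t) (i := i)
    rcases (hcases v.2.2).2 hoff with e | e | e | e <;> simp only [e] at hzero
    · exact Or.inr (Or.inl ⟨hzero _ _ (by decide) (by decide) (by decide) (by decide),
        hzero _ _ (by decide) (by decide) (by decide) (by decide)⟩)
    · exact Or.inr (Or.inr ⟨hzero _ _ (by decide) (by decide) (by decide) (by decide),
        hzero _ _ (by decide) (by decide) (by decide) (by decide)⟩)
    all_goals exact Or.inl ⟨hzero _ _ (by decide) (by decide) (by decide) (by decide),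
      hzero _ _ (by decide) (by decide) (by decide) (by decide)⟩
  by_cases h : r = 1 ∧ (pos v % 9 = 1 ∨ pos v % 9 = 4)
  · obtain ⟨rfl, h⟩ := h
    have h00 : ballCount v 1 0 0 + ballCount v 1 1 0 ≤ 1 := by omega
    have h04 : ballCount v 1 0 4 + ballCount v 1 1 4 ≤ 1 := by omega
    have h05 : ballCount v 1 0 5 + ballCount v 1 1 5 ≤ 1 := by omega
    have h25 : ballCount v 1 2 5 = 0 := by omega
    have := hsun rfl h
    clear b00 b04 b05 b10 b14 b15 b25
    omega
  · have hfloor := floor_sum_le (x := x) (y := y) (by clear hsun; omega) (by omega)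
    have hxy : x - y - 1 = 2 * r := by rw [hx, hy]; ring
    clear hsun hx hy
    zify
    linarith

theorem broadcastDominationNumber_graph (hk : 0 < k) :
    broadcastDominationNumber (graph k) = 4 * k := by
  refine IsLeast.csInf_eq ⟨⟨_, isDominatingBroadcast_blockBroadcast hk, ?_⟩, ?_⟩
  · rw [finsum_eq_sum_of_fintype, sum_blockBroadcast]
  · rintro _ ⟨f, hf, rfl⟩
    have h := sum_weight_le_mul_cost weight 2 (sum_weight_ball_le hk) hf
    rw [sum_weight] at h
    rw [finsum_eq_sum_of_fintype]
    omega

end SunChain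

/-- For every positive integer k, there is a finite connected chordal
graph F_k with MP(F_k) = 3k and γ_b(F_k) = 4k. -/
theorem stmt5 (k : ℕ) (hk : 0 < k) :
    ∃ (V : Type) (G : SimpleGraph V), Finite V ∧ G.Connected ∧ IsChordal G ∧
      multipackingNumber G = 3 * k ∧ broadcastDominationNumber G = 4 * k := by
  exact ⟨SunChainVertex k, SunChain.graph k, inferInstance, SunChain.connected_graph hk,
    SunChain.isChordal_graph k, SunChain.multipackingNumber_graph hk,
    SunChain.broadcastDominationNumber_graph hk⟩
end
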